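/- Suppose p > p_S and fix n ≥ 1. Then for all sufficiently large γ > 1 the solution u(·,γ) has at least n positive critical points, and its n-th positive critical point s_n(γ) satisfies s_n(γ) → s_n* as γ → ∞; equivalently, λ_n(γ) := s_n(γ)² converges to λ_n* := (s_n*)² as γ → ∞. -/

import Mathlib

open Real Set Filter Topology MeasureTheory

noncomputable section

/-- The nonlinearity `f(u) = -u + u^p`. -/
def fNL (p u : ℝ) : ℝ := -u + u ^ p

/-- The Sobolev critical exponent `p_S = (N+2)/(N-2)`. -/
def pSob (N : ℕ) : ℝ := ((N : ℝ) + 2) / ((N : ℝ) - 2)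

/-- `θ = 2/(p-1)`. -/
def thetaP (p : ℝ) : ℝ := 2 / (p - 1)

/-- `A = (θ(N-2-θ))^{1/(p-1)}`. -/
def Aconst (N : ℕ) (p : ℝ) : ℝ :=
  (thetaP p * ((N : ℝ) - 2 - thetaP p)) ^ (1 / (p - 1))

/-- `m = (θ(N-2-θ))^{-1/2}`. -/
def mConst (N : ℕ) (p : ℝ) : ℝ :=
  (thetaP p * ((N : ℝ) - 2 - thetaP p)) ^ (-(1 / 2) : ℝ)

/-- `α = m(N-2-2θ)`. -/
def alphaConst (N : ℕ) (p : ℝ) : ℝ :=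
  mConst N p * ((N : ℝ) - 2 - 2 * thetaP p)

/-- The condition `p < p_JL`, where `p_JL = 1 + 4/(N-4-2√(N-1))` for `N ≥ 11` and
`p_JL = ∞` for `N ≤ 10`. -/
def pJLcond (N : ℕ) (p : ℝ) : Prop :=
  11 ≤ N → p < 1 + 4 / ((N : ℝ) - 4 - 2 * Real.sqrt ((N : ℝ) - 1))

/-- `y` is a C² solution of `y'' + α y' - y + y^p - m² e^{2mt} y = 0` on `(-∞, T]`
with `y → 1` as `t → -∞`; `y'`, `y''` are its first and second derivatives. -/
def IsSingODEOn (N : ℕ) (p T : ℝ) (y y' y'' : ℝ → ℝ) : Prop :=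
  (∀ t ∈ Iic T, HasDerivWithinAt y (y' t) (Iic T) t) ∧
  (∀ t ∈ Iic T, HasDerivWithinAt y' (y'' t) (Iic T) t) ∧
  ContinuousOn y'' (Iic T) ∧
  (∀ t ∈ Iic T, y'' t + alphaConst N p * y' t - y t + y t ^ p
      - (mConst N p) ^ 2 * Real.exp (2 * mConst N p * t) * y t = 0) ∧
  Tendsto y atBot (𝓝 1)

/-- `y` is a C² solution of `y'' + α y' - y + y^p - m² e^{2mt} y = 0` on all of `ℝ`
with `y → 1` as `t → -∞`. -/
def IsEntireSingODE (N : ℕ) (p : ℝ) (y y' y'' : ℝ → ℝ) : Prop :=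
  (∀ t : ℝ, HasDerivAt y (y' t) t) ∧
  (∀ t : ℝ, HasDerivAt y' (y'' t) t) ∧
  Continuous y'' ∧
  (∀ t : ℝ, y'' t + alphaConst N p * y' t - y t + y t ^ p
      - (mConst N p) ^ 2 * Real.exp (2 * mConst N p * t) * y t = 0) ∧
  Tendsto y atBot (𝓝 1)

/-- The singular solution `u*(s) = A s^{-θ} y*(m⁻¹ log s)` built from `y*`. -/
def ustar (N : ℕ) (p : ℝ) (y : ℝ → ℝ) (s : ℝ) : ℝ :=
  Aconst N p * s ^ (-(thetaP p)) * y (Real.log s / mConst N p)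

/-- `u` is a C² solution on `[0,∞)` of the IVP `u'' + ((N-1)/s)u' + f(u) = 0`,
`u(0) = γ`, `u'(0) = 0`, with nonlinearity `f(u) = -u + u^p`. -/
def IsIVPSol (N : ℕ) (p γ : ℝ) (u u' u'' : ℝ → ℝ) : Prop :=
  (∀ s ∈ Ici (0:ℝ), HasDerivWithinAt u (u' s) (Ici 0) s) ∧
  (∀ s ∈ Ici (0:ℝ), HasDerivWithinAt u' (u'' s) (Ici 0) s) ∧
  ContinuousOn u'' (Ici 0) ∧
  u 0 = γ ∧ u' 0 = 0 ∧
  (∀ s > (0:ℝ), u'' s + ((N : ℝ) - 1) / s * u' s + fNL p (u s) = 0)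

/-- `u` is a C² solution on `[0,∞)` of the IVP `u'' + ((N-1)/ρ)u' + u^p = 0`,
`u(0) = γ`, `u'(0) = 0`. -/
def IsBarSol (N : ℕ) (p γ : ℝ) (u u' u'' : ℝ → ℝ) : Prop :=
  (∀ ρ ∈ Ici (0:ℝ), HasDerivWithinAt u (u' ρ) (Ici 0) ρ) ∧
  (∀ ρ ∈ Ici (0:ℝ), HasDerivWithinAt u' (u'' ρ) (Ici 0) ρ) ∧
  ContinuousOn u'' (Ici 0) ∧
  u 0 = γ ∧ u' 0 = 0 ∧
  (∀ ρ > (0:ℝ), u'' ρ + ((N : ℝ) - 1) / ρ * u' ρ + u ρ ^ p = 0)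

/-- `s` is the `(k+1)`-th positive critical point of a function whose derivative is `u'`:
`s` is a positive critical point having exactly `k` positive critical points below it. -/
def IsNthCritPt (u' : ℝ → ℝ) (k : ℕ) (s : ℝ) : Prop :=
  0 < s ∧ u' s = 0 ∧ {x : ℝ | 0 < x ∧ x < s ∧ u' x = 0}.encard = (k : ℕ∞)

/-- `U` is a positive C² radial solution of the Neumann problem
`U'' + ((N-1)/r)U' + λ f(U) = 0` on `(0,1)`, `U'(0) = U'(1) = 0`, `U > 0` on `[0,1]`. -/
def NeumannSol (N : ℕ) (p lam : ℝ) (U U' U'' : ℝ → ℝ) : Prop :=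
  (∀ r ∈ Icc (0:ℝ) 1, HasDerivWithinAt U (U' r) (Icc 0 1) r) ∧
  (∀ r ∈ Icc (0:ℝ) 1, HasDerivWithinAt U' (U'' r) (Icc 0 1) r) ∧
  ContinuousOn U'' (Icc 0 1) ∧
  (∀ r ∈ Ioo (0:ℝ) 1, U'' r + ((N : ℝ) - 1) / r * U' r + lam * fNL p (U r) = 0) ∧
  U' 0 = 0 ∧ U' 1 = 0 ∧ (∀ r ∈ Icc (0:ℝ) 1, 0 < U r)

/-- `(lam, U)` is a singular solution of the Neumann problem whose graph meets `1`
exactly `n` times: `U` is C² on `(0,1)`, continuous on `(0,1]`, `U'(1) = 0`, it solves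
`U'' + ((N-1)/r)U' + λ f(U) = 0` on `(0,1)`, satisfies the asymptotics
`U(r) = A(√λ r)^{-θ}(1+o(1))` as `r ↓ 0` (i.e. `r^θ U(r) → A λ^{-θ/2}`),
`U - 1` has exactly `n` zeros in `(0,1]`, and `U > 0` on `(0,1]`. -/
def SingBVPSol (N : ℕ) (p lam : ℝ) (n : ℕ) (U U' U'' : ℝ → ℝ) : Prop :=
  (∀ r ∈ Ioc (0:ℝ) 1, HasDerivWithinAt U (U' r) (Ioc 0 1) r) ∧
  (∀ r ∈ Ioo (0:ℝ) 1, HasDerivAt U' (U'' r) r) ∧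
  ContinuousOn U (Ioc 0 1) ∧
  ContinuousOn U'' (Ioo 0 1) ∧
  (∀ r ∈ Ioo (0:ℝ) 1, U'' r + ((N : ℝ) - 1) / r * U' r + lam * fNL p (U r) = 0) ∧
  U' 1 = 0 ∧
  Tendsto (fun r => r ^ thetaP p * U r) (𝓝[>] (0:ℝ))
    (𝓝 (Aconst N p * lam ^ (-(thetaP p) / 2))) ∧
  {r ∈ Ioc (0:ℝ) 1 | U r = 1}.encard = (n : ℕ∞) ∧
  (∀ r ∈ Ioc (0:ℝ) 1, 0 < U r)

/-- A continuous function starting below `r` stays below `r` on `[a, b]` as soon as the bound `≤ r`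
on an initial segment always improves to `< r`. -/
lemma lt_on_Icc_of_bootstrap {f : ℝ → ℝ} {a b r : ℝ} (hf : ContinuousOn f (Icc a b)) (ha : f a < r)
    (h : ∀ t ∈ Icc a b, (∀ s ∈ Icc a t, f s ≤ r) → f t < r) : ∀ t ∈ Icc a b, f t < r := by
  by_contra! hcon
  obtain ⟨t, ht, hrt⟩ := hcon
  have hcont : ContinuousOn f (Icc a t) := hf.mono (Icc_subset_Icc_right ht.2)
  have hne : (Icc a t ∩ f ⁻¹' {r}).Nonempty := by
    obtain ⟨x, hx, hxr⟩ := intermediate_value_Icc ht.1 hcont ⟨ha.le, hrt⟩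
    exact ⟨x, hx, hxr⟩
  have hcpt : IsCompact (Icc a t ∩ f ⁻¹' {r}) :=
    isCompact_Icc.of_isClosed_subset
      (hcont.preimage_isClosed_of_isClosed isClosed_Icc isClosed_singleton) inter_subset_left
  obtain ⟨s₀, ⟨hs₀, hs₀r⟩, hleast⟩ := hcpt.exists_isLeast hne
  have hs₀r' : f s₀ = r := hs₀r
  have hlt := h s₀ ⟨hs₀.1, hs₀.2.trans ht.2⟩ (by
    intro s hs
    by_contra! hsr
    obtain ⟨x, hx, hxr⟩ := intermediate_value_Icc hs.1
      (hcont.mono (Icc_subset_Icc_right (hs.2.trans hs₀.2))) ⟨ha.le, hsr.le⟩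
    have hxs : s₀ ≤ x := hleast ⟨⟨hx.1, hx.2.trans (hs.2.trans hs₀.2)⟩, hxr⟩
    have : s = s₀ := le_antisymm hs.2 (hxs.trans hx.2)
    rw [this] at hsr
    linarith)
  linarith

/-- Two-sided Grönwall inequality for a function with `|Q'| ≤ C Q`. -/
lemma gronwall_two_sided {Q Q' : ℝ → ℝ} {a b C : ℝ} (hab : a ≤ b)
    (hd : ∀ t ∈ Icc a b, HasDerivAt Q (Q' t) t) (hC : ∀ t ∈ Icc a b, |Q' t| ≤ C * Q t) :
    ∀ t ∈ Icc a b, Q t ≤ Q a * exp (C * (t - a)) ∧ Q t ≤ Q b * exp (C * (b - t)) := by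
  have hc : ContinuousOn Q (Icc a b) := fun t ht => (hd t ht).continuousAt.continuousWithinAt
  have key : ∀ (σ : ℝ) (t : ℝ), t ∈ Icc a b →
      HasDerivAt (fun x => Q x * exp (σ * x)) ((Q' t + σ * Q t) * exp (σ * t)) t := by
    intro σ t ht
    have h1 : HasDerivAt (fun x : ℝ => σ * x) σ t := by
      simpa using (hasDerivAt_id t).const_mul σ
    exact ((hd t ht).mul h1.exp).congr_deriv (by ring)
  have hce : ∀ σ : ℝ, ContinuousOn (fun x => Q x * exp (σ * x)) (Icc a b) := fun σ t ht =>
    (key σ t ht).continuousAt.continuousWithinAt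
  have anti : AntitoneOn (fun x => Q x * exp (-C * x)) (Icc a b) := by
    refine antitoneOn_of_hasDerivWithinAt_nonpos (convex_Icc a b) (hce _)
      (fun x hx => (key (-C) x (interior_subset hx)).hasDerivWithinAt) (fun x hx => ?_)
    have := (abs_le.1 (hC x (interior_subset hx))).2
    exact mul_nonpos_of_nonpos_of_nonneg (by linarith) (exp_pos _).le
  have mono : MonotoneOn (fun x => Q x * exp (C * x)) (Icc a b) := by
    refine monotoneOn_of_hasDerivWithinAt_nonneg (convex_Icc a b) (hce _)
      (fun x hx => (key C x (interior_subset hx)).hasDerivWithinAt) (fun x hx => ?_)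
    have := (abs_le.1 (hC x (interior_subset hx))).1
    exact mul_nonneg (by linarith) (exp_pos _).le
  intro t ht
  have h1 := anti (left_mem_Icc.2 hab) ht ht.1
  have h2 := mono ht (right_mem_Icc.2 hab) ht.2
  simp only at h1 h2
  constructor
  · have : exp (C * (t - a)) = exp (-C * a) / exp (-C * t) := by
      rw [← exp_sub]; congr 1; ring
    rw [this, ← mul_div_assoc, le_div_iff₀ (exp_pos _)]
    exact h1
  · have : exp (C * (b - t)) = exp (C * b) / exp (C * t) := by
      rw [← exp_sub]; congr 1; ring
    rw [this, ← mul_div_assoc, le_div_iff₀ (exp_pos _)]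
    exact h2

/-- Solutions of the Emden-Fowler form `z'' + b z' - (β + e^{2τ}) z + z^p = 0` on `ℝ`. -/
structure IsEFSol (b β p : ℝ) (z z' : ℝ → ℝ) : Prop where
  d1 : ∀ τ, HasDerivAt z (z' τ) τ
  d2 : ∀ τ, HasDerivAt z' (-b * z' τ - z τ ^ p + (β + exp (2 * τ)) * z τ) τ

lemma hasDerivAt_exp_two_mul (τ : ℝ) :
    HasDerivAt (fun x : ℝ => exp (2 * x)) (2 * exp (2 * τ)) τ := by
  have h1 : HasDerivAt (fun x : ℝ => 2 * x) 2 τ := by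
    simpa using (hasDerivAt_id τ).const_mul 2
  exact h1.exp.congr_deriv (by ring)

lemma abs_rpow_sub_rpow_le {p M x y : ℝ} (hp : 1 < p) (hx : |x| ≤ M) (hy : |y| ≤ M) :
    |x ^ p - y ^ p| ≤ p * M ^ (p - 1) * |x - y| := by
  have h := (convex_Icc (-M) M).norm_image_sub_le_of_norm_hasDerivWithin_le
    (f := fun x : ℝ => x ^ p) (f' := fun x => p * x ^ (p - 1)) (C := p * M ^ (p - 1)) (x := y)
    (y := x)
    (fun w _ => (Real.hasDerivAt_rpow_const (Or.inr hp.le)).hasDerivWithinAt) (fun w hw => by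
      rw [Real.norm_eq_abs, abs_mul, abs_of_pos (by linarith : (0:ℝ) < p)]
      have h1 : |w| ≤ M := abs_le.2 hw
      have h2 := (Real.abs_rpow_le_abs_rpow w (p - 1)).trans
        (Real.rpow_le_rpow (abs_nonneg _) h1 (by linarith : 0 ≤ p - 1))
      exact mul_le_mul_of_nonneg_left h2 (by linarith)) (abs_le.1 hy) (abs_le.1 hx)
  simpa [Real.norm_eq_abs] using h

/-- The energy `z'²/2 + z^{p+1}/(p+1) - (β + e^{2τ}) z²/2`. -/
def efEnergy (β p : ℝ) (z z' : ℝ → ℝ) (τ : ℝ) : ℝ :=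
  z' τ ^ 2 / 2 + z τ ^ (p + 1) / (p + 1) - (β + exp (2 * τ)) * z τ ^ 2 / 2

lemma IsEFSol.hasDerivAt_energy {b β p : ℝ} {z z' : ℝ → ℝ} (hp : 1 < p) (h : IsEFSol b β p z z')
    (τ : ℝ) : HasDerivAt (efEnergy β p z z')
      (-b * z' τ ^ 2 - exp (2 * τ) * z τ ^ 2) τ := by
  have h1 := ((h.d2 τ).pow 2).div_const 2
  have h2 := ((h.d1 τ).rpow_const (p := p + 1) (Or.inr (by linarith))).div_const (p + 1)
  have h3 := ((((hasDerivAt_exp_two_mul τ).const_add β).mul ((h.d1 τ).pow 2))).div_const 2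
  refine ((h1.add h2).sub h3).congr_deriv ?_
  have : p + 1 - 1 = p := by ring
  rw [this]
  have hp' : p + 1 ≠ 0 := by linarith
  field_simp
  simp
  ring

lemma IsEFSol.antitone_energy {b β p : ℝ} {z z' : ℝ → ℝ} (hb : 0 < b) (hp : 1 < p)
    (h : IsEFSol b β p z z') : Antitone (efEnergy β p z z') := by
  refine antitone_of_hasDerivAt_nonpos (fun τ => h.hasDerivAt_energy hp τ) (fun τ => ?_)
  have := mul_nonneg (exp_pos (2 * τ)).le (sq_nonneg (z τ))
  have := mul_nonneg hb.le (sq_nonneg (z' τ))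
  show _ ≤ (0:ℝ)
  linarith

/-- Continuous dependence on initial data and uniqueness, both in time directions. -/
lemma exists_gronwall_const {b β p : ℝ} (hb : 0 < b) (hβ : 0 < β) (hp : 1 < p) (M T : ℝ) :
    ∃ C, ∀ z z' w w' : ℝ → ℝ, IsEFSol b β p z z' → IsEFSol b β p w w' → ∀ a t₂, a ≤ t₂ → t₂ ≤ T →
      (∀ t ∈ Icc a t₂, |z t| ≤ M ∧ |w t| ≤ M) → ∀ t ∈ Icc a t₂,
      (z t - w t) ^ 2 + (z' t - w' t) ^ 2 ≤
        ((z a - w a) ^ 2 + (z' a - w' a) ^ 2) * exp (C * (t - a)) ∧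
      (z t - w t) ^ 2 + (z' t - w' t) ^ 2 ≤
        ((z t₂ - w t₂) ^ 2 + (z' t₂ - w' t₂) ^ 2) * exp (C * (t₂ - t)) := by
  set P := p * |M| ^ (p - 1)
  have hP : 0 ≤ P := by positivity
  refine ⟨1 + 2 * b + P + β + exp (2 * T), ?_⟩
  intro z z' w w' hz hw a t₂ hat htT hM
  refine gronwall_two_sided (Q := fun t => (z t - w t) ^ 2 + (z' t - w' t) ^ 2) hat
    (fun t _ => (((hz.d1 t).sub (hw.d1 t)).pow 2).add (((hz.d2 t).sub (hw.d2 t)).pow 2)) ?_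
  intro t ht
  have hlip : |z t ^ p - w t ^ p| ≤ P * |z t - w t| :=
    abs_rpow_sub_rpow_le hp ((hM t ht).1.trans (le_abs_self M))
    ((hM t ht).2.trans (le_abs_self M))
  have he : exp (2 * t) ≤ exp (2 * T) := exp_le_exp.2 (by linarith [ht.2])
  have he0 := exp_pos (2 * t)
  simp only [Pi.sub_apply]
  set x := z t - w t
  set y := z' t - w' t
  set d := z t ^ p - w t ^ p
  have hexpr : (2:ℕ) * x ^ (2 - 1) * (z' t - w' t) + (2:ℕ) * y ^ (2 - 1) *
      (-b * z' t - z t ^ p + (β + exp (2 * t)) * z t -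
        (-b * w' t - w t ^ p + (β + exp (2 * t)) * w t)) =
      2 * x * y - 2 * b * y ^ 2 - 2 * y * d + 2 * (β + exp (2 * t)) * (x * y) := by
    simp only [x, y, d]; push_cast; ring
  rw [hexpr]
  clear_value P x y d
  have hxy : 2 * |x * y| ≤ x ^ 2 + y ^ 2 := by
    rw [abs_mul]; nlinarith [sq_nonneg (|x| - |y|), sq_abs x, sq_abs y]
  have hyd : 2 * |y * d| ≤ P * (x ^ 2 + y ^ 2) := by
    rw [abs_mul]
    rw [abs_mul] at hxy
    linarith [mul_le_mul_of_nonneg_left hlip (abs_nonneg y), mul_le_mul_of_nonneg_left hxy hP]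
  have hexy : 2 * (β + exp (2 * t)) * |x * y| ≤ (β + exp (2 * T)) * (x ^ 2 + y ^ 2) := by
    linarith [mul_le_mul_of_nonneg_left hxy (by positivity : 0 ≤ β + exp (2 * t)),
      mul_le_mul_of_nonneg_right he (by positivity : 0 ≤ x ^ 2 + y ^ 2)]
  have hxy1 := abs_le.1 (le_refl |x * y|)
  have hyd1 := abs_le.1 (le_refl |y * d|)
  have hk : 0 < 2 * (β + exp (2 * t)) := by positivity
  have h5 := mul_le_mul_of_nonneg_left hxy1.1 hk.le
  have h6 := mul_le_mul_of_nonneg_left hxy1.2 hk.le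
  have hbx := mul_nonneg hb.le (sq_nonneg x)
  have hby := mul_nonneg hb.le (sq_nonneg y)
  rw [abs_le]
  constructor <;> linarith [hxy1.1, hxy1.2, hyd1.1, hyd1.2]

lemma rpow_eq_mul_rpow_sub_one {x p : ℝ} (hx : 0 < x) : x ^ p = x * x ^ (p - 1) := by
  rw [Real.rpow_sub_one hx.ne']; field_simp

lemma eq_of_rpow_eq_mul {A β p x : ℝ} (hp : 1 < p) (hA : 0 < A) (hAβ : A ^ (p - 1) = β)
    (hx : 0 < x) (h : x ^ p = β * x) : x = A := by
  rw [rpow_eq_mul_rpow_sub_one hx, mul_comm, ← hAβ] at h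
  have h2 := mul_right_cancel₀ hx.ne' h
  exact (Real.rpow_left_inj hx.le hA.le (by linarith)).1 h2

lemma exists_near_of_rpow_sub_small {A β p c M ε : ℝ} (hp : 1 < p) (hA : 0 < A)
    (hAβ : A ^ (p - 1) = β) (hc : 0 < c) (hε : 0 < ε) :
    ∃ η > 0, ∀ x ∈ Icc c M, |x ^ p - β * x| < η → |x - A| < ε := by
  set K := Icc c M ∩ {x | ε ≤ |x - A|} with hK
  have hKc : IsCompact K :=
    isCompact_Icc.inter_right (isClosed_le continuous_const (by fun_prop))
  rcases K.eq_empty_or_nonempty with hE | hN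
  · refine ⟨1, one_pos, fun x hx _ => ?_⟩
    by_contra! hcon
    have : x ∈ K := ⟨hx, hcon⟩
    rw [hE] at this
    exact this
  · have hcont : Continuous fun x : ℝ => |x ^ p - β * x| := by
      have := Real.continuous_rpow_const (q := p) (by linarith)
      fun_prop
    obtain ⟨x₀, hx₀, hmin⟩ := hKc.exists_isMinOn hN hcont.continuousOn
    refine ⟨|x₀ ^ p - β * x₀|, ?_, fun x hx hlt => ?_⟩
    · refine abs_pos.2 fun h0 => ?_
      have := eq_of_rpow_eq_mul hp hA hAβ (hc.trans_le hx₀.1.1) (by linarith)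
      have h2 : ε ≤ |x₀ - A| := hx₀.2
      rw [this] at h2
      simp at h2
      linarith
    · by_contra! hcon
      have : |x₀ ^ p - β * x₀| ≤ |x ^ p - β * x| := hmin ⟨hx, hcon⟩
      linarith

lemma dissipation_algebra {b κ G v g g' e z : ℝ} (hκ : 0 < κ) (hκ1 : κ ≤ 1)
    (hκb : κ * (G + b ^ 2) ≤ b / 2) (hg' : g' ≤ G) (he : 0 < e) (he1 : e ≤ 1) :
    -b * v ^ 2 - e * z ^ 2 + κ * ((-b * v - g + e * z) * g + v * (g' * v)) ≤
      -(b / 2) * v ^ 2 - κ / 2 * g ^ 2 := by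
  have h1 : κ * (g' * v ^ 2) ≤ κ * (G * v ^ 2) :=
    mul_le_mul_of_nonneg_left (mul_le_mul_of_nonneg_right hg' (sq_nonneg v)) hκ.le
  have h2 := mul_le_mul_of_nonneg_right hκb (sq_nonneg v)
  have h3 := mul_nonneg hκ.le (sq_nonneg (b * v + g / 2))
  have h4 := mul_nonneg hκ.le (sq_nonneg (e * z - g / 2))
  have h5 : κ * (e * e) ≤ e := by nlinarith [mul_pos he he]
  have h6 := mul_le_mul_of_nonneg_right h5 (sq_nonneg z)
  nlinarith

/-- A solution confined to a compact subset of `{z > 0}` over a long interval has to come close to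
the equilibrium `(A, 0)` of the autonomous equation. -/
lemma exists_long_time_near {A b β p c M ε : ℝ} (hb : 0 < b) (hβ : 0 < β) (hp : 1 < p)
    (hA : 0 < A) (hAβ : A ^ (p - 1) = β) (hc : 0 < c) (hM : 0 < M) (hε : 0 < ε) :
    ∃ L : ℝ, ∀ z z' : ℝ → ℝ, IsEFSol b β p z z' → ∀ a T : ℝ, T ≤ 0 → L ≤ T - a →
      (∀ t ∈ Icc a T, z t ∈ Icc c M ∧ |z' t| ≤ M) →
      ∃ t ∈ Icc a T, |z t - A| < ε ∧ |z' t| < ε := by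
  obtain ⟨η₁, hη₁, hnear⟩ := exists_near_of_rpow_sub_small (M := M) hp hA hAβ hc hε
  set η := min (ε ^ 2) (η₁ ^ 2)
  have hη : 0 < η := lt_min (by positivity) (by positivity)
  set G := p * M ^ (p - 1) + M ^ p + β * M with hG
  have hGpos : 0 < G := by positivity
  set κ := min 1 (b / 2 / (G + b ^ 2))
  have hκ : 0 < κ := lt_min one_pos (by positivity)
  have hκ1 : κ ≤ 1 := min_le_left _ _
  have hκb : κ * (G + b ^ 2) ≤ b / 2 := by
    have : κ ≤ b / 2 / (G + b ^ 2) := min_le_right _ _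
    rwa [le_div_iff₀ (by positivity)] at this
  set μ := min (b / 2) (κ / 2)
  have hμ : 0 < μ := lt_min (by positivity) (by positivity)
  set C := M ^ 2 / 2 + M ^ (p + 1) / (p + 1) + (β + 1) * M ^ 2 / 2 + M * G with hC
  have hCpos : 0 < C := by positivity
  refine ⟨2 * C / (μ * η) + 1, fun z z' hz a T hT hL hbd => ?_⟩
  have hL0 : a < T := by
    have : 0 < 2 * C / (μ * η) := by positivity
    linarith
  by_contra! hcon
  have hbig : ∀ t ∈ Icc a T, η ≤ z' t ^ 2 + (z t ^ p - β * z t) ^ 2 := by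
    intro t ht
    by_contra! hlt
    have h1 : |z t ^ p - β * z t| < η₁ := by
      apply abs_lt_of_sq_lt_sq _ hη₁.le
      have : η ≤ η₁ ^ 2 := min_le_right _ _
      nlinarith [sq_nonneg (z' t)]
    have h2 : |z' t| < ε := by
      apply abs_lt_of_sq_lt_sq _ hε.le
      have : η ≤ ε ^ 2 := min_le_left _ _
      nlinarith [sq_nonneg (z t ^ p - β * z t)]
    exact absurd h2 (not_lt.2 (hcon t ht (hnear _ (hbd t ht).1 h1)))
  set W : ℝ → ℝ := fun t => efEnergy β p z z' t + κ * (z' t * (z t ^ p - β * z t)) + μ * η * t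
    with hW
  have hWd : ∀ t, HasDerivAt W (-b * z' t ^ 2 - exp (2 * t) * z t ^ 2 +
      κ * ((-b * z' t - (z t ^ p - β * z t) + exp (2 * t) * z t) * (z t ^ p - β * z t) +
        z' t * ((p * z t ^ (p - 1) - β) * z' t)) + μ * η) t := by
    intro t
    have h1 := hz.hasDerivAt_energy hp t
    have h2 := ((hz.d1 t).rpow_const (p := p) (Or.inr hp.le)).sub ((hz.d1 t).const_mul β)
    have h3 := (((hz.d2 t).mul h2).const_mul κ)
    have h4 : HasDerivAt (fun t : ℝ => μ * η * t) (μ * η) t := by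
      simpa using (hasDerivAt_id t).const_mul (μ * η)
    exact ((h1.add h3).add h4).congr_deriv (by simp only [Pi.sub_apply]; ring)
  have hWanti : AntitoneOn W (Icc a T) := by
    refine antitoneOn_of_hasDerivWithinAt_nonpos (convex_Icc a T)
      (fun t _ => (hWd t).continuousAt.continuousWithinAt)
      (fun t _ => (hWd t).hasDerivWithinAt) (fun t ht => ?_)
    have ht' := interior_subset ht
    have hzt := (hbd t ht').1
    have hz0 : 0 < z t := hc.trans_le hzt.1
    have he1 : exp (2 * t) ≤ 1 := exp_le_one_iff.2 (by linarith [ht'.2])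
    have hg' : p * z t ^ (p - 1) - β ≤ G := by
      have : z t ^ (p - 1) ≤ M ^ (p - 1) := Real.rpow_le_rpow hz0.le hzt.2 (by linarith)
      have := mul_le_mul_of_nonneg_left this (by linarith : 0 ≤ p)
      have h1 : 0 < M ^ p := by positivity
      have h2 : 0 < β * M := by positivity
      linarith
    have hd := dissipation_algebra (v := z' t) (g := z t ^ p - β * z t) (z := z t) hκ hκ1 hκb hg'
      (exp_pos (2 * t)) he1
    have h1 := mul_le_mul_of_nonneg_right (min_le_left (b / 2) (κ / 2)) (sq_nonneg (z' t))
    have h2 := mul_le_mul_of_nonneg_right (min_le_right (b / 2) (κ / 2))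
      (sq_nonneg (z t ^ p - β * z t))
    have h3 := mul_le_mul_of_nonneg_left (hbig t ht') hμ.le
    change μ * _ ≤ _ at h1
    change μ * _ ≤ _ at h2
    linarith
  have hbound : ∀ t ∈ Icc a T,
      |efEnergy β p z z' t + κ * (z' t * (z t ^ p - β * z t))| ≤ C := by
    intro t ht
    obtain ⟨hzt, hz't⟩ := hbd t ht
    have hz0 : 0 < z t := hc.trans_le hzt.1
    have e0 := exp_pos (2 * t)
    have e1 : exp (2 * t) ≤ 1 := exp_le_one_iff.2 (by linarith [ht.2])
    have a1 : z' t ^ 2 ≤ M ^ 2 := sq_le_sq' (abs_le.1 hz't).1 (abs_le.1 hz't).2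
    have a2 : z t ^ (p + 1) / (p + 1) ≤ M ^ (p + 1) / (p + 1) :=
      div_le_div_of_nonneg_right (Real.rpow_le_rpow hz0.le hzt.2 (by linarith)) (by linarith)
    have a2' : 0 ≤ z t ^ (p + 1) / (p + 1) :=
      div_nonneg (Real.rpow_nonneg hz0.le _) (by linarith)
    have a3 : z t ^ 2 ≤ M ^ 2 := pow_le_pow_left₀ hz0.le hzt.2 2
    have a4 : (β + exp (2 * t)) * z t ^ 2 ≤ (β + 1) * M ^ 2 := by gcongr
    have a4' : 0 ≤ (β + exp (2 * t)) * z t ^ 2 := by positivity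
    have a5 : |z t ^ p - β * z t| ≤ G := by
      have h1 : z t ^ p ≤ M ^ p := Real.rpow_le_rpow hz0.le hzt.2 (by linarith)
      have h2 : β * z t ≤ β * M := mul_le_mul_of_nonneg_left hzt.2 hβ.le
      have h3 : 0 ≤ z t ^ p := Real.rpow_nonneg hz0.le _
      have h4 : 0 ≤ β * z t := by positivity
      have h5 : 0 < p * M ^ (p - 1) := by positivity
      rw [abs_le]; constructor <;> linarith
    have a6 : |κ * (z' t * (z t ^ p - β * z t))| ≤ M * G := by
      rw [abs_mul, abs_mul, abs_of_pos hκ]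
      calc κ * (|z' t| * |z t ^ p - β * z t|) ≤ 1 * (M * G) := by gcongr
        _ = M * G := one_mul _
    have a7 := abs_le.1 a6
    have a8 := sq_nonneg (z' t)
    have a9 : 0 ≤ M ^ (p + 1) / (p + 1) := a2'.trans a2
    have a10 : 0 ≤ (β + 1) * M ^ 2 := a4'.trans a4
    unfold efEnergy
    rw [abs_le]; constructor <;> linarith [a7.1, a7.2, sq_nonneg M]
  have hfin := hWanti (left_mem_Icc.2 hL0.le) (right_mem_Icc.2 hL0.le) hL0.le
  have b1 := (abs_le.1 (hbound a (left_mem_Icc.2 hL0.le))).2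
  have b2 := (abs_le.1 (hbound T (right_mem_Icc.2 hL0.le))).1
  simp only [hW] at hfin
  have hμη : 0 < μ * η := mul_pos hμ hη
  have hlast : 2 * C / (μ * η) < T - a := by linarith
  rw [div_lt_iff₀ hμη] at hlast
  linarith

lemma contraction_algebra {b k κ δ x y e : ℝ} (hb : 0 < b) (hκ : 0 < κ)
    (hκb : κ ≤ b / 2) (hκk : κ * (4 * b) ≤ k) (hδb : δ ≤ κ * b) (hδk : δ ≤ k / 2)
    (he : |e| ≤ δ * |x|) :
    y * (-b * y - k * x + e) + k * (x * y) + κ * (y * y + x * (-b * y - k * x + e)) ≤ 0 := by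
  have h1 : |e| * |y| ≤ κ * b * |x| * |y| :=
    mul_le_mul_of_nonneg_right (he.trans (mul_le_mul_of_nonneg_right hδb (abs_nonneg x)))
      (abs_nonneg y)
  have h2 : |e| * |x| ≤ k / 2 * |x| * |x| :=
    mul_le_mul_of_nonneg_right (he.trans (mul_le_mul_of_nonneg_right hδk (abs_nonneg x)))
      (abs_nonneg x)
  have h1' : y * e ≤ κ * b * (|x| * |y|) := by
    have := le_abs_self (y * e); rw [abs_mul] at this; linarith
  have h2' : κ * (x * e) ≤ κ * (k / 2 * x ^ 2) := by
    have := le_abs_self (x * e); rw [abs_mul] at this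
    refine mul_le_mul_of_nonneg_left ?_ hκ.le
    rw [← sq_abs x]; linarith
  have h3 : -(κ * b) * (x * y) ≤ κ * b * (|x| * |y|) := by
    have := neg_abs_le (x * y); rw [abs_mul] at this
    nlinarith [mul_pos hκ hb]
  have h4 : 0 ≤ b * (|y| / 2 - 2 * κ * |x|) ^ 2 := by positivity
  have h5 : κ * y ^ 2 ≤ b / 2 * y ^ 2 := mul_le_mul_of_nonneg_right hκb (sq_nonneg y)
  have h6 : κ * (κ * (4 * b)) * x ^ 2 ≤ κ * k * x ^ 2 :=
    mul_le_mul_of_nonneg_right (mul_le_mul_of_nonneg_left hκk hκ.le) (sq_nonneg x)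
  have h7 : b * (|y| / 2 - 2 * κ * |x|) ^ 2 =
      b * y ^ 2 / 4 - 2 * (κ * b * (|x| * |y|)) + 4 * κ ^ 2 * b * x ^ 2 := by
    rw [← sq_abs x, ← sq_abs y]; ring
  have h8 : 0 ≤ b * (|y| - 2 * κ * |x|) ^ 2 := by positivity
  have h9 : b * (|y| - 2 * κ * |x|) ^ 2 =
      b * y ^ 2 - 4 * (κ * b * (|x| * |y|)) + 4 * κ ^ 2 * b * x ^ 2 := by
    rw [← sq_abs x, ← sq_abs y]; ring
  nlinarith

lemma sq_add_sq_le_of_lyapunov_le {k κ q Q x y X Y : ℝ} (hκ2 : κ ^ 2 ≤ k / 4) (hq : 0 < q)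
    (hq1 : q ≤ 1) (hqk : q ≤ k) (hQ1 : 1 ≤ Q) (hQk : k ≤ Q)
    (h : y ^ 2 / 2 + k * x ^ 2 / 2 + κ * (x * y) ≤ Y ^ 2 / 2 + k * X ^ 2 / 2 + κ * (X * Y)) :
    x ^ 2 + y ^ 2 ≤ 3 * Q / q * (X ^ 2 + Y ^ 2) := by
  have cross : ∀ x y : ℝ, |κ * (x * y)| ≤ y ^ 2 / 4 + k * x ^ 2 / 4 := by
    intro x y
    have h0 := mul_le_mul_of_nonneg_right hκ2 (sq_nonneg x)
    rw [abs_le]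
    constructor <;> nlinarith [sq_nonneg (y / 2 - κ * x), sq_nonneg (y / 2 + κ * x)]
  have c1 := (abs_le.1 (cross x y)).1
  have c2 := (abs_le.1 (cross X Y)).2
  rw [div_mul_eq_mul_div, le_div_iff₀ hq]
  have d1 := mul_le_mul_of_nonneg_right hq1 (sq_nonneg y)
  have d2 := mul_le_mul_of_nonneg_right hqk (sq_nonneg x)
  have d3 := mul_le_mul_of_nonneg_right hQ1 (sq_nonneg Y)
  have d4 := mul_le_mul_of_nonneg_right hQk (sq_nonneg X)
  linarith

/-- Forward stability, near the equilibrium `(A, 0)` and for very negative times, of the difference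
of two solutions. -/
lemma exists_stability_const {A b β p : ℝ} (hb : 0 < b) (hβ : 0 < β) (hp : 1 < p)
    (hAβ : A ^ (p - 1) = β) :
    ∃ r > 0, ∃ τ₀ : ℝ, ∃ C ≥ 1, ∀ z z' w w' : ℝ → ℝ, IsEFSol b β p z z' → IsEFSol b β p w w' →
      ∀ T t₁, T ≤ t₁ → t₁ ≤ τ₀ → (∀ t ≤ t₁, |w t - A| ≤ r) →
      C * ((z T - w T) ^ 2 + (z' T - w' T) ^ 2) < r ^ 2 →
      ∀ t ∈ Icc T t₁, (z t - w t) ^ 2 + (z' t - w' t) ^ 2 ≤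
        C * ((z T - w T) ^ 2 + (z' T - w' T) ^ 2) := by
  set k := (p - 1) * β with hk
  have hkpos : 0 < k := mul_pos (by linarith) hβ
  set κ := min (b / 2) (k / (4 * b))
  have hκ : 0 < κ := lt_min (by positivity) (by positivity)
  have hκb : κ ≤ b / 2 := min_le_left _ _
  have hκk : κ * (4 * b) ≤ k := by
    have : κ ≤ k / (4 * b) := min_le_right _ _
    rwa [le_div_iff₀ (by positivity)] at this
  have hκ2 : κ ^ 2 ≤ k / 4 := by nlinarith
  set δ := min (κ * b) (k / 2)
  have hδ : 0 < δ := lt_min (by positivity) (by positivity)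
  have hδb : δ ≤ κ * b := min_le_left _ _
  have hδk : δ ≤ k / 2 := min_le_right _ _
  obtain ⟨r₁, hr₁, hball⟩ : ∃ r₁ > 0, ∀ x, |x - A| < r₁ →
      |p * x ^ (p - 1) - p * A ^ (p - 1)| < δ / 2 := by
    have hcont : Continuous fun x : ℝ => p * x ^ (p - 1) := by
      have := Real.continuous_rpow_const (q := p - 1) (by linarith)
      fun_prop
    have := Metric.continuousAt_iff.1 (hcont.continuousAt (x := A)) (δ / 2) (by positivity)
    simpa [Real.dist_eq] using this
  have hlin : ∀ x y, |x - A| ≤ r₁ / 2 → |y - A| ≤ r₁ / 2 →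
      |x ^ p - y ^ p - p * A ^ (p - 1) * (x - y)| ≤ δ / 2 * |x - y| := by
    intro x y hx hy
    have h := (convex_Icc (A - r₁ / 2) (A + r₁ / 2)).norm_image_sub_le_of_norm_hasDerivWithin_le
      (f := fun x : ℝ => x ^ p - p * A ^ (p - 1) * x)
      (f' := fun x => p * x ^ (p - 1) - p * A ^ (p - 1)) (C := δ / 2) (x := y) (y := x)
      (fun w _ => by
        have h4 : HasDerivAt (fun t : ℝ => p * A ^ (p - 1) * t) (p * A ^ (p - 1)) w := by
          simpa using (hasDerivAt_id w).const_mul (p * A ^ (p - 1))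
        exact ((Real.hasDerivAt_rpow_const (Or.inr hp.le)).sub h4).hasDerivWithinAt)
      (fun w hw => by
        refine (hball w ?_).le
        rw [abs_lt]; constructor <;> linarith [hw.1, hw.2])
      (by rw [abs_le] at hy; constructor <;> linarith [hy.1, hy.2])
      (by rw [abs_le] at hx; constructor <;> linarith [hx.1, hx.2])
    simp only [Real.norm_eq_abs] at h
    convert h using 2
    ring
  set Q := max 1 k
  set q := min 1 k
  have hq : 0 < q := lt_min one_pos hkpos
  have hQ1 : 1 ≤ Q := le_max_left _ _
  have hQk : k ≤ Q := le_max_right _ _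
  have hq1 : q ≤ 1 := min_le_left _ _
  have hqk : q ≤ k := min_le_right _ _
  have hC1 : 1 ≤ 3 * Q / q := by rw [le_div_iff₀ hq]; linarith
  refine ⟨r₁ / 4, by positivity, Real.log (δ / 2) / 2, 3 * Q / q, hC1, ?_⟩
  intro z z' w w' hz hw T t₁ hT ht₁ hwA hsmall
  set V : ℝ → ℝ := fun t => (z' t - w' t) ^ 2 / 2 + k * (z t - w t) ^ 2 / 2 +
    κ * ((z t - w t) * (z' t - w' t)) with hV
  have hVd : ∀ t, HasDerivAt V _ t := fun t =>
    ((((hz.d2 t).sub (hw.d2 t)).pow 2).div_const 2).add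
      (((((hz.d1 t).sub (hw.d1 t)).pow 2).const_mul k).div_const 2) |>.add
      ((((hz.d1 t).sub (hw.d1 t)).mul ((hz.d2 t).sub (hw.d2 t))).const_mul κ)
  have key : ∀ t ∈ Icc T t₁, (∀ s ∈ Icc T t, |z s - w s| ≤ r₁ / 4) →
      (z t - w t) ^ 2 + (z' t - w' t) ^ 2 ≤
        3 * Q / q * ((z T - w T) ^ 2 + (z' T - w' T) ^ 2) := by
    intro t ht hs
    have hanti : AntitoneOn V (Icc T t) := by
      refine antitoneOn_of_hasDerivWithinAt_nonpos (convex_Icc T t)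
        (fun s _ => (hVd s).continuousAt.continuousWithinAt)
        (fun s _ => (hVd s).hasDerivWithinAt) (fun s hs' => ?_)
      have hs'' := interior_subset hs'
      have hst₁ : s ≤ t₁ := hs''.2.trans ht.2
      have hx := hs s hs''
      have hws := hwA s hst₁
      have hzs : |z s - A| ≤ r₁ / 2 := by
        have := abs_add_le (z s - w s) (w s - A)
        rw [sub_add_sub_cancel] at this
        linarith
      have hl := hlin (z s) (w s) hzs (by linarith)
      have he : exp (2 * s) ≤ δ / 2 := by
        rw [← Real.exp_log (by positivity : 0 < δ / 2)]
        exact exp_le_exp.2 (by linarith)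
      have hal := contraction_algebra (x := z s - w s) (y := z' s - w' s)
        (e := -(z s ^ p - w s ^ p - p * A ^ (p - 1) * (z s - w s)) + exp (2 * s) * (z s - w s))
        hb hκ hκb hκk hδb hδk (by
          refine (abs_add_le _ _).trans ?_
          rw [abs_neg, abs_mul, abs_of_pos (exp_pos _)]
          have := mul_le_mul_of_nonneg_right he (abs_nonneg (z s - w s))
          linarith)
      refine le_of_eq_of_le ?_ hal
      rw [hAβ, hk]
      simp only [Pi.sub_apply]
      push_cast
      ring
    have h := hanti (left_mem_Icc.2 ht.1) (right_mem_Icc.2 ht.1) ht.1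
    exact sq_add_sq_le_of_lyapunov_le hκ2 hq hq1 hqk hQ1 hQk h
  have hcz : Continuous fun t => |z t - w t| := by
    have h1 : Continuous z := continuous_iff_continuousAt.2 fun t => (hz.d1 t).continuousAt
    have h2 : Continuous w := continuous_iff_continuousAt.2 fun t => (hw.d1 t).continuousAt
    fun_prop
  have hboot := lt_on_Icc_of_bootstrap (f := fun t => |z t - w t|) (a := T) (b := t₁) (r := r₁ / 4)
    hcz.continuousOn
    (by
      refine abs_lt_of_sq_lt_sq ?_ (by positivity)
      have h0 : 0 ≤ (z T - w T) ^ 2 + (z' T - w' T) ^ 2 := by positivity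
      nlinarith [sq_nonneg (z' T - w' T)])
    (fun t ht hs => by
      refine abs_lt_of_sq_lt_sq ?_ (by positivity)
      have := key t ht hs
      nlinarith [sq_nonneg (z' t - w' t)])
  exact fun t ht => key t ht fun s hs => (hboot s ⟨hs.1, hs.2.trans ht.2⟩).le

/-- A solution converging at `-∞` has vanishing derivative at `-∞`. -/
lemma IsEFSol.tendsto_deriv {A b β p : ℝ} {z z' : ℝ → ℝ}
    (hA : 0 < A) (hAβ : A ^ (p - 1) = β) (h : IsEFSol b β p z z') (hz : Tendsto z atBot (𝓝 A)) :
    Tendsto z' atBot (𝓝 0) := by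
  have hsub : Tendsto (fun t : ℝ => t - 1) atBot atBot :=
    tendsto_atBot_add_const_right _ _ tendsto_id
  have hexp : Tendsto (fun t : ℝ => exp (2 * t)) atBot (𝓝 0) :=
    Real.tendsto_exp_atBot.comp (tendsto_id.const_mul_atBot two_pos)
  have hH : Tendsto (fun t => -z t ^ p + (β + exp (2 * t)) * z t) atBot (𝓝 0) := by
    have h1 : Tendsto (fun t => z t ^ p) atBot (𝓝 (A ^ p)) :=
      hz.rpow_const (Or.inl hA.ne')
    have := h1.neg.add ((hexp.const_add β).mul hz)
    have e : -A ^ p + (β + 0) * A = 0 := by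
      rw [rpow_eq_mul_rpow_sub_one hA, hAβ]; ring
    rwa [e] at this
  rw [Metric.tendsto_nhds] at hz hH ⊢
  intro ε hε
  set η := ε / (4 * (1 + |b|)) with hη
  have hηpos : 0 < η := by positivity
  have hηε : η * (4 * (1 + |b|)) = ε := by rw [hη]; field_simp
  obtain ⟨t₁, ht₁⟩ := eventually_atBot.1 (hz η hηpos)
  obtain ⟨t₂, ht₂⟩ := eventually_atBot.1 (hH η hηpos)
  refine eventually_atBot.2 ⟨min t₁ t₂, fun t ht => ?_⟩
  have htt₁ : t ≤ t₁ := ht.trans (min_le_left _ _)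
  have htt₂ : t ≤ t₂ := ht.trans (min_le_right _ _)
  have hc : Continuous z := continuous_iff_continuousAt.2 fun t => (h.d1 t).continuousAt
  obtain ⟨ξ, hξ, hξeq⟩ := exists_hasDerivAt_eq_slope z z' (sub_one_lt t) hc.continuousOn
    (fun x _ => h.d1 x)
  have hq : ∀ x, HasDerivAt (fun s => z' s + b * z s) (-z x ^ p + (β + exp (2 * x)) * z x) x :=
    fun x => ((h.d2 x).add ((h.d1 x).const_mul b)).congr_deriv (by ring)
  obtain ⟨ζ, hζ, hζeq⟩ := exists_hasDerivAt_eq_slope _ _ hξ.2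
    (fun x _ => (hq x).continuousAt.continuousWithinAt) (fun x _ => hq x)
  have hz1 := ht₁ t htt₁
  have hz2 := ht₁ (t - 1) (by linarith)
  have hz3 := ht₁ ξ (hξ.2.le.trans htt₁)
  have hz4 := ht₂ ζ (hζ.2.le.trans htt₂)
  simp only [Real.dist_eq, sub_zero] at hz1 hz2 hz3 hz4 ⊢
  rw [hζeq, abs_div, abs_of_pos (by linarith [hξ.2] : 0 < t - ξ),
    div_lt_iff₀ (by linarith [hξ.2])] at hz4
  rw [sub_sub_cancel, div_one] at hξeq
  have hlen : η * (t - ξ) ≤ η := by nlinarith [hξ.1]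
  have hbz : |b * (z t - z ξ)| ≤ |b| * (2 * η) := by
    rw [abs_mul]
    refine mul_le_mul_of_nonneg_left ?_ (abs_nonneg b)
    have := abs_sub_le (z t) A (z ξ)
    rw [abs_sub_comm A] at this
    linarith
  rw [abs_lt] at hz1 hz2 hz4 ⊢
  rw [abs_le] at hbz
  constructor <;> nlinarith [abs_nonneg b]

lemma mul_rpow_of_pos {a : ℝ} (ha : 0 < a) (x p : ℝ) : (a * x) ^ p = a ^ p * x ^ p := by
  rcases le_or_gt 0 x with hx | hx
  · exact Real.mul_rpow ha.le hx
  · rw [Real.rpow_def_of_neg (mul_neg_of_pos_of_neg ha hx), Real.rpow_def_of_neg hx,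
      Real.rpow_def_of_pos ha, Real.log_mul ha.ne' hx.ne, add_mul, Real.exp_add, mul_assoc]

/-- The Emden-Fowler variable `e^{θτ} u(e^τ)`. -/
def efVar (θ : ℝ) (u : ℝ → ℝ) (τ : ℝ) : ℝ := exp (θ * τ) * u (exp τ)

/-- The derivative of the Emden-Fowler variable. -/
def efVarDeriv (θ : ℝ) (u u' : ℝ → ℝ) (τ : ℝ) : ℝ :=
  exp (θ * τ) * (θ * u (exp τ) + exp τ * u' (exp τ))

lemma isEFSol_efVar {N : ℕ} {p θ γ : ℝ} {u u' u'' : ℝ → ℝ} (hθ : θ * (p - 1) = 2)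
    (h : IsIVPSol N p γ u u' u'') :
    IsEFSol (N - 2 - 2 * θ) (θ * (N - 2 - θ)) p (efVar θ u) (efVarDeriv θ u u') := by
  obtain ⟨hd1, hd2, -, -, -, hode⟩ := h
  have hexpθ : ∀ τ, HasDerivAt (fun t : ℝ => exp (θ * t)) (θ * exp (θ * τ)) τ := fun τ => by
    have h1 : HasDerivAt (fun x : ℝ => θ * x) θ τ := by
      simpa using (hasDerivAt_id τ).const_mul θ
    exact h1.exp.congr_deriv (by ring)
  have hu : ∀ τ, HasDerivAt (fun t => u (exp t)) (u' (exp τ) * exp τ) τ := fun τ =>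
    ((hd1 _ (exp_pos τ).le).hasDerivAt (Ici_mem_nhds (exp_pos τ))).comp τ (Real.hasDerivAt_exp τ)
  have hu' : ∀ τ, HasDerivAt (fun t => u' (exp t)) (u'' (exp τ) * exp τ) τ := fun τ =>
    ((hd2 _ (exp_pos τ).le).hasDerivAt (Ici_mem_nhds (exp_pos τ))).comp τ (Real.hasDerivAt_exp τ)
  refine ⟨fun τ => ((hexpθ τ).mul (hu τ)).congr_deriv (by simp only [efVarDeriv]; ring),
    fun τ => ((hexpθ τ).mul (((hu τ).const_mul θ).add
      ((Real.hasDerivAt_exp τ).mul (hu' τ)))).congr_deriv ?_⟩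
  have ho := hode (exp τ) (exp_pos τ)
  have hpow : efVar θ u τ ^ p = exp (θ * τ) * exp (2 * τ) * u (exp τ) ^ p := by
    rw [efVar, mul_rpow_of_pos (exp_pos _), ← Real.exp_mul, ← Real.exp_add]
    congr 2
    linear_combination τ * hθ
  rw [hpow]
  have he2 : exp (2 * τ) = exp τ * exp τ := by rw [← Real.exp_add]; congr 1; ring
  have hu2 : u'' (exp τ) = -((N - 1) / exp τ * u' (exp τ)) + u (exp τ) - u (exp τ) ^ p := by
    simp only [fNL] at ho; linarith
  rw [hu2, he2]
  simp only [efVar, efVarDeriv, Pi.add_apply, Pi.mul_apply]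
  have := (exp_pos τ).ne'
  field_simp
  ring

lemma IsIVPSol.hasDerivAt_pow_mul {j : ℕ} {p γ : ℝ} {u u' u'' : ℝ → ℝ}
    (h : IsIVPSol (j + 2) p γ u u' u'') {s : ℝ} (hs : 0 < s) :
    HasDerivAt (fun x => x ^ (j + 1) * u' x) (-(s ^ (j + 1) * fNL p (u s))) s := by
  obtain ⟨-, hd2, -, -, -, hode⟩ := h
  refine ((hasDerivAt_pow (j + 1) s).mul
    ((hd2 s hs.le).hasDerivAt (Ici_mem_nhds hs))).congr_deriv ?_
  have ho := hode s hs
  have : fNL p (u s) = -(u'' s + ((j + 2 : ℕ) - 1) / s * u' s) := by linarith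
  rw [this]
  push_cast
  field_simp
  ring

lemma IsIVPSol.continuousOn {N : ℕ} {p γ : ℝ} {u u' u'' : ℝ → ℝ} (h : IsIVPSol N p γ u u' u'') :
    ContinuousOn u (Ici 0) ∧ ContinuousOn u' (Ici 0) :=
  ⟨fun s hs => (h.1 s hs).continuousWithinAt, fun s hs => (h.2.1 s hs).continuousWithinAt⟩

lemma IsIVPSol.deriv_neg {N : ℕ} (hN : 3 ≤ N) {p γ : ℝ} {u u' u'' : ℝ → ℝ} (hp : 1 < p)
    (h : IsIVPSol N p γ u u' u'') {S : ℝ} (hS : ∀ s ∈ Ioc 0 S, 1 < u s) :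
    ∀ s ∈ Ioc 0 S, u' s < 0 := by
  obtain ⟨j, rfl⟩ : ∃ j, N = j + 2 := ⟨N - 2, by omega⟩
  intro s hs
  have hc : ContinuousOn (fun x => x ^ (j + 1) * u' x) (Icc 0 s) :=
    (continuousOn_pow _).mul (h.continuousOn.2.mono Icc_subset_Ici_self)
  have hanti : StrictAntiOn (fun x => x ^ (j + 1) * u' x) (Icc 0 s) := by
    refine strictAntiOn_of_hasDerivWithinAt_neg (convex_Icc 0 s) hc
      (f' := fun x => -(x ^ (j + 1) * fNL p (u x))) (fun x hx => ?_) (fun x hx => ?_)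
    all_goals rw [interior_Icc] at hx
    · exact (h.hasDerivAt_pow_mul hx.1).hasDerivWithinAt
    · have hx1 := hS x ⟨hx.1, hx.2.le.trans hs.2⟩
      have hf : 0 < fNL p (u x) := by
        have : u x < u x ^ p := by
          simpa using Real.rpow_lt_rpow_of_exponent_lt hx1 hp
        simp only [fNL]; linarith
      have := mul_pos (pow_pos hx.1 (j + 1)) hf
      simpa using this
  have := hanti (left_mem_Icc.2 hs.1.le) (right_mem_Icc.2 hs.1.le) hs.1
  simp only [ne_eq, Nat.add_eq_zero_iff, one_ne_zero, and_false, not_false_eq_true, zero_pow,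
    zero_mul] at this
  exact neg_of_mul_neg_right this (pow_pos hs.1 (j + 1)).le

lemma IsIVPSol.initial_bounds {N : ℕ} (hN : 3 ≤ N) {p γ : ℝ} {u u' u'' : ℝ → ℝ} (hp : 1 < p)
    (h : IsIVPSol N p γ u u' u'') {S : ℝ} (hS : ∀ s ∈ Icc 0 S, 1 ≤ u s) :
    ∀ s ∈ Icc 0 S, u s ≤ γ ∧ u' s ≤ 0 ∧ -(γ ^ p * s / N) ≤ u' s ∧
      γ - γ ^ p * s ^ 2 / (2 * N) ≤ u s := by
  obtain ⟨j, rfl⟩ : ∃ j, N = j + 2 := ⟨N - 2, by omega⟩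
  have hcu := h.continuousOn.1.mono (Icc_subset_Ici_self (a := S) (b := 0))
  have hcu' := h.continuousOn.2.mono (Icc_subset_Ici_self (a := S) (b := 0))
  have hc : ContinuousOn (fun x => x ^ (j + 1) * u' x) (Icc 0 S) :=
    (continuousOn_pow _).mul hcu'
  have hu0 : u 0 = γ := h.2.2.2.1
  have hu'0 : u' 0 = 0 := h.2.2.2.2.1
  have hdu : ∀ x ∈ interior (Icc 0 S), HasDerivAt u (u' x) x := fun x hx => by
    rw [interior_Icc] at hx
    exact (h.1 x hx.1.le).hasDerivAt (Ici_mem_nhds hx.1)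
  have hneg : ∀ s ∈ Icc 0 S, u' s ≤ 0 := by
    intro s hs
    rcases hs.1.eq_or_lt with rfl | hs0
    · exact hu'0.le
    have hanti : AntitoneOn (fun x => x ^ (j + 1) * u' x) (Icc 0 S) := by
      refine antitoneOn_of_hasDerivWithinAt_nonpos (convex_Icc 0 S) hc
        (f' := fun x => -(x ^ (j + 1) * fNL p (u x))) (fun x hx => ?_) (fun x hx => ?_)
      all_goals rw [interior_Icc] at hx
      · exact (h.hasDerivAt_pow_mul hx.1).hasDerivWithinAt
      · have hx1 := hS x ⟨hx.1.le, hx.2.le⟩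
        have hf : 0 ≤ fNL p (u x) := by
          have : u x ≤ u x ^ p := by
            simpa using Real.rpow_le_rpow_of_exponent_le hx1 hp.le
          simp only [fNL]; linarith
        have := mul_nonneg (pow_pos hx.1 (j + 1)).le hf
        simpa using this
    have := hanti (left_mem_Icc.2 (hs.1.trans hs.2)) hs hs.1
    simp only [ne_eq, Nat.add_eq_zero_iff, one_ne_zero, and_false, not_false_eq_true, zero_pow,
      zero_mul] at this
    exact nonpos_of_mul_nonpos_right this (pow_pos hs0 _)
  have hle : ∀ s ∈ Icc 0 S, u s ≤ γ := by
    intro s hs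
    have hanti : AntitoneOn u (Icc 0 S) :=
      antitoneOn_of_hasDerivWithinAt_nonpos (convex_Icc 0 S) hcu
        (fun x hx => (hdu x hx).hasDerivWithinAt) (fun x hx => hneg x (interior_subset hx))
    have := hanti (left_mem_Icc.2 (hs.1.trans hs.2)) hs hs.1
    rwa [hu0] at this
  have hlow : ∀ s ∈ Icc 0 S, -(γ ^ p * s / (j + 2 : ℕ)) ≤ u' s := by
    intro s hs
    rcases hs.1.eq_or_lt with rfl | hs0
    · simp [hu'0]
    have hmono : MonotoneOn (fun x => x ^ (j + 1) * u' x + γ ^ p * x ^ (j + 2) / (j + 2 : ℕ))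
        (Icc 0 S) := by
      refine monotoneOn_of_hasDerivWithinAt_nonneg (convex_Icc 0 S) (hc.add (by fun_prop))
        (f' := fun x => -(x ^ (j + 1) * fNL p (u x)) + γ ^ p * x ^ (j + 1))
        (fun x hx => ?_) (fun x hx => ?_)
      all_goals rw [interior_Icc] at hx
      · refine ((h.hasDerivAt_pow_mul hx.1).add
          (((hasDerivAt_pow (j + 2) x).const_mul (γ ^ p)).div_const
            ((j + 2 : ℕ) : ℝ))).hasDerivWithinAt.congr_deriv ?_
        have : ((j + 2 : ℕ) : ℝ) ≠ 0 := by positivity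
        field_simp
        simp
        ring
      · have hx' : x ∈ Icc 0 S := ⟨hx.1.le, hx.2.le⟩
        have h1 : u x ^ p ≤ γ ^ p :=
          Real.rpow_le_rpow (by linarith [hS x hx']) (hle x hx') (by linarith)
        have h2 : 0 ≤ γ ^ p - fNL p (u x) := by
          simp only [fNL]; linarith [hS x hx']
        have := mul_nonneg (pow_pos hx.1 (j + 1)).le h2
        linarith
    have := hmono (left_mem_Icc.2 (hs.1.trans hs.2)) hs hs.1
    simp only [ne_eq, Nat.add_eq_zero_iff, one_ne_zero, and_false, not_false_eq_true, zero_pow,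
      zero_mul, mul_zero, zero_div, add_zero, OfNat.ofNat_ne_zero] at this
    have e : s ^ (j + 1) * u' s + γ ^ p * s ^ (j + 2) / (j + 2 : ℕ) =
      s ^ (j + 1) * (u' s + γ ^ p * s / (j + 2 : ℕ)) := by ring
    rw [e] at this
    have := (mul_nonneg_iff_of_pos_left (pow_pos hs0 _)).1 this
    linarith
  refine fun s hs => ⟨hle s hs, hneg s hs, hlow s hs, ?_⟩
  have hmono : MonotoneOn (fun x => u x + γ ^ p * x ^ 2 / (2 * (j + 2 : ℕ))) (Icc 0 S) := by
    refine monotoneOn_of_hasDerivWithinAt_nonneg (convex_Icc 0 S) (hcu.add (by fun_prop))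
      (f' := fun x => u' x + γ ^ p * x / (j + 2 : ℕ))
      (fun x hx => ?_) (fun x hx => ?_)
    · refine ((hdu x hx).add
        (((hasDerivAt_pow 2 x).const_mul (γ ^ p)).div_const
          (2 * ((j + 2 : ℕ) : ℝ)))).hasDerivWithinAt.congr_deriv ?_
      have : ((j + 2 : ℕ) : ℝ) ≠ 0 := by positivity
      field_simp
      simp
      ring
    · linarith [hlow x (interior_subset hx)]
  have := hmono (left_mem_Icc.2 (hs.1.trans hs.2)) hs hs.1
  simp only [hu0, ne_eq, OfNat.ofNat_ne_zero, not_false_eq_true, zero_pow, mul_zero, zero_div,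
    add_zero] at this
  linarith

lemma IsIVPSol.initial_stage {N : ℕ} (hN : 3 ≤ N) {p θ γ κ : ℝ} {u u' u'' : ℝ → ℝ} (hp : 1 < p)
    (hθ : θ * (p - 1) = 2) (hκ : 0 < κ) (hκ1 : κ ^ 2 ≤ 1) (hκθ : 4 * κ ^ 2 ≤ θ) (hγ : 2 < γ)
    (h : IsIVPSol N p γ u u' u'') :
    ∀ τ ≤ Real.log κ - Real.log γ / θ, γ / 2 ≤ u (exp τ) ∧ u (exp τ) ≤ γ ∧
      -(θ * γ / 4) ≤ exp τ * u' (exp τ) := by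
  have hγ0 : 0 < γ := by linarith
  have hN' : (3:ℝ) ≤ N := by exact_mod_cast hN
  have hθ0 : 0 < θ := by nlinarith
  set S := exp (Real.log κ - Real.log γ / θ) with hSdef
  have hSpos : 0 < S := exp_pos _
  have hS2 : γ ^ p * S ^ 2 = κ ^ 2 * γ := by
    have e1 : S = κ * exp (-(Real.log γ / θ)) := by
      rw [hSdef, sub_eq_add_neg, Real.exp_add, Real.exp_log hκ]
    have e2 : γ ^ p * exp (-(Real.log γ / θ)) ^ 2 = γ := by
      rw [Real.rpow_def_of_pos hγ0, ← Real.exp_nat_mul, ← Real.exp_add]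
      nth_rewrite 3 [← Real.exp_log hγ0]
      congr 1
      push_cast
      field_simp
      linear_combination Real.log γ * hθ
    rw [e1, mul_pow]
    linear_combination κ ^ 2 * e2
  have hsq : ∀ s ∈ Icc 0 S, γ ^ p * s ^ 2 ≤ κ ^ 2 * γ := by
    intro s hs
    rw [← hS2]
    exact mul_le_mul_of_nonneg_left (pow_le_pow_left₀ hs.1 hs.2 2) (Real.rpow_nonneg hγ0.le _)
  have hhalf : ∀ s ∈ Icc 0 S, γ - γ ^ p * s ^ 2 / (2 * N) ≥ γ / 2 := by
    intro s hs
    have h1 : γ ^ p * s ^ 2 / (2 * N) ≤ γ / 2 := by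
      rw [div_le_iff₀ (by linarith)]
      have := hsq s hs
      nlinarith
    linarith
  have hge : ∀ s ∈ Icc 0 S, -u s < -1 := by
    refine lt_on_Icc_of_bootstrap (h.continuousOn.1.mono Icc_subset_Ici_self).neg ?_ ?_
    · rw [h.2.2.2.1]; linarith
    · intro t ht hprev
      have := (h.initial_bounds hN hp (S := t) (fun s hs => by linarith [hprev s hs])
        t (right_mem_Icc.2 ht.1)).2.2.2
      linarith [hhalf t ht]
  intro τ hτ
  have hmem : exp τ ∈ Icc 0 S := ⟨(exp_pos τ).le, exp_le_exp.2 hτ⟩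
  obtain ⟨h1, -, h3, h4⟩ := h.initial_bounds hN hp (fun s hs => by linarith [hge s hs]) _ hmem
  refine ⟨(hhalf _ hmem).le.trans h4, h1, ?_⟩
  have h5 := mul_le_mul_of_nonneg_left h3 (exp_pos τ).le
  refine le_trans ?_ h5
  have h6 : exp τ * -(γ ^ p * exp τ / N) = -(γ ^ p * exp τ ^ 2 / N) := by ring
  rw [h6, neg_le_neg_iff, div_le_iff₀ (by linarith)]
  have := hsq _ hmem
  have h7 : 0 < θ * γ := by positivity
  nlinarith

/-- Uniform (in `γ`) negativity of the energy of the regular solutions past the initial stage. -/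
lemma IsIVPSol.energy_and_pos {N : ℕ} (hN : 3 ≤ N) {p θ γ κ : ℝ} {u u' u'' : ℝ → ℝ} (hp : 1 < p)
    (hθ : θ * (p - 1) = 2) (hb : 0 < N - 2 - 2 * θ) (hκ : 0 < κ) (hκ1 : κ ^ 2 ≤ 1)
    (hκθ : 4 * κ ^ 2 ≤ θ) (hγ : 2 < γ) (h : IsIVPSol N p γ u u' u'') :
    (∀ τ ≥ Real.log κ - Real.log γ / θ,
      efEnergy (θ * (N - 2 - θ)) p (efVar θ u) (efVarDeriv θ u u') τ ≤
        -((N - 2 - 2 * θ) * θ / 32 * exp (2 * θ * Real.log κ)) ∧ 0 < efVar θ u τ) := by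
  set b := (N:ℝ) - 2 - 2 * θ
  set β := θ * ((N:ℝ) - 2 - θ)
  set τ₁ := Real.log κ - Real.log γ / θ with hτ₁
  have hγ0 : 0 < γ := by linarith
  have hθ0 : 0 < θ := by nlinarith
  have hsol := isEFSol_efVar hθ h
  have hstage := h.initial_stage hN hp hθ hκ hκ1 hκθ hγ
  have hexpθ : ∀ τ, HasDerivAt (fun t : ℝ => exp (2 * θ * t)) (2 * θ * exp (2 * θ * τ)) τ :=
    fun τ => by
    have h1 : HasDerivAt (fun x : ℝ => 2 * θ * x) (2 * θ) τ := by
      simpa using (hasDerivAt_id τ).const_mul (2 * θ)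
    exact h1.exp.congr_deriv (by ring)
  set E := efEnergy β p (efVar θ u) (efVarDeriv θ u u') with hE
  have hanti : AntitoneOn (fun τ => E τ + b * θ * γ ^ 2 / 32 * exp (2 * θ * τ)) (Iic τ₁) := by
    have hd : ∀ τ, HasDerivAt (fun τ => E τ + b * θ * γ ^ 2 / 32 * exp (2 * θ * τ)) _ τ := fun τ =>
      (hsol.hasDerivAt_energy hp τ).add ((hexpθ τ).const_mul _)
    refine antitoneOn_of_hasDerivWithinAt_nonpos (convex_Iic τ₁)
      (fun τ _ => (hd τ).continuousAt.continuousWithinAt)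
      (fun τ _ => (hd τ).hasDerivWithinAt) (fun τ hτ => ?_)
    obtain ⟨h1, h2, h3⟩ := hstage τ (mem_Iic.1 (interior_subset hτ))
    have hz' : exp (θ * τ) * (θ * γ / 4) ≤ efVarDeriv θ u u' τ := by
      refine mul_le_mul_of_nonneg_left ?_ (exp_pos _).le
      nlinarith
    have hz'2 := pow_le_pow_left₀ (by positivity) hz' 2
    have e2 : exp (2 * θ * τ) = exp (θ * τ) ^ 2 := by
      rw [← Real.exp_nat_mul]; congr 1; push_cast; ring
    rw [e2]
    have h4 := mul_le_mul_of_nonneg_left hz'2 hb.le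
    have h5 : 0 ≤ exp (2 * τ) * efVar θ u τ ^ 2 := by positivity
    nlinarith
  have hlim : Tendsto (fun τ => E τ + b * θ * γ ^ 2 / 32 * exp (2 * θ * τ)) atBot (𝓝 0) := by
    have hexp0 : Tendsto exp atBot (𝓝[Ici 0] 0) :=
      tendsto_nhdsWithin_iff.2 ⟨Real.tendsto_exp_atBot, Eventually.of_forall fun x =>
        (exp_pos x).le⟩
    have hu : Tendsto (fun τ => u (exp τ)) atBot (𝓝 (u 0)) :=
      (h.continuousOn.1 0 self_mem_Ici).tendsto.comp hexp0
    have hu' : Tendsto (fun τ => u' (exp τ)) atBot (𝓝 (u' 0)) :=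
      (h.continuousOn.2 0 self_mem_Ici).tendsto.comp hexp0
    have hl : ∀ c : ℝ, 0 < c → Tendsto (fun τ : ℝ => exp (c * τ)) atBot (𝓝 0) := fun c hc =>
      Real.tendsto_exp_atBot.comp (tendsto_id.const_mul_atBot hc)
    have hz : Tendsto (efVar θ u) atBot (𝓝 0) := by
      have := (hl θ hθ0).mul hu
      rwa [zero_mul] at this
    have hz' : Tendsto (efVarDeriv θ u u') atBot (𝓝 0) := by
      have := (hl θ hθ0).mul ((hu.const_mul θ).add (Real.tendsto_exp_atBot.mul hu'))
      rwa [zero_mul] at this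
    have := ((((hz'.pow 2).div_const 2).add ((hz.rpow_const (p := p + 1)
      (Or.inr (by linarith))).div_const (p + 1))).sub
      ((((hl 2 two_pos).const_add β).mul (hz.pow 2)).div_const 2)).add
      ((hl (2 * θ) (by linarith)).const_mul (b * θ * γ ^ 2 / 32))
    have e0 : (0:ℝ) ^ 2 / 2 + 0 ^ (p + 1) / (p + 1) - (β + 0) * 0 ^ 2 / 2 +
        b * θ * γ ^ 2 / 32 * 0 = 0 := by
      rw [Real.zero_rpow (by linarith)]; simp
    rwa [e0] at this
  have hE₁ : E τ₁ + b * θ * γ ^ 2 / 32 * exp (2 * θ * τ₁) ≤ 0 := by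
    refine ge_of_tendsto hlim ?_
    filter_upwards [eventually_le_atBot τ₁] with τ hτ
    exact hanti hτ self_mem_Iic hτ
  have hval : γ ^ 2 * exp (2 * θ * τ₁) = exp (2 * θ * Real.log κ) := by
    nth_rewrite 1 [← Real.exp_log hγ0]
    rw [← Real.exp_nat_mul, ← Real.exp_add]
    congr 1
    rw [hτ₁]
    push_cast
    field_simp
    ring
  have hEle : ∀ τ ≥ τ₁, E τ ≤ -(b * θ / 32 * exp (2 * θ * Real.log κ)) := by
    intro τ hτ
    have := hsol.antitone_energy hb hp hτ
    change E τ ≤ E τ₁ at this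
    rw [← hval]
    linarith
  intro τ hτ
  refine ⟨hEle τ hτ, ?_⟩
  by_contra! hneg
  have hc : Continuous (efVar θ u) :=
    continuous_iff_continuousAt.2 fun t => (hsol.d1 t).continuousAt
  have hpos₁ : 0 < efVar θ u τ₁ := by
    have := (hstage τ₁ le_rfl).1
    exact mul_pos (exp_pos _) (by linarith)
  obtain ⟨ξ, hξ, hξ0⟩ := intermediate_value_Icc' hτ hc.continuousOn ⟨hneg, hpos₁.le⟩
  have h1 := hEle ξ hξ.1
  have h2 : 0 < b * θ / 32 * exp (2 * θ * Real.log κ) := by positivity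
  rw [hE, efEnergy, hξ0, Real.zero_rpow (by linarith), zero_div] at h1
  nlinarith [sq_nonneg (efVarDeriv θ u u' ξ)]

/-- Negative energy confines a positive solution to a compact set, for times bounded above. -/
lemma exists_bounds_of_energy {β p c₀ : ℝ} (hβ : 0 < β) (hp : 1 < p) (hc₀ : 0 < c₀) (T : ℝ) :
    ∃ c > 0, ∃ M > 0, ∀ z z' : ℝ → ℝ, ∀ t ≤ T, 0 < z t → efEnergy β p z z' t ≤ -c₀ →
      z t ∈ Icc c M ∧ |z' t| ≤ M := by
  set B := β + exp (2 * T)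
  have hB : 0 < B := by positivity
  set M₀ := ((p + 1) * B / 2) ^ (1 / (p - 1))
  have hM₀ : 0 < M₀ := by positivity
  refine ⟨Real.sqrt (2 * c₀ / B), Real.sqrt_pos.2 (by positivity), max M₀ (Real.sqrt (B * M₀ ^ 2)),
    lt_max_of_lt_left hM₀, fun z z' t ht hz hE => ?_⟩
  have hBt : β + exp (2 * t) ≤ B := by
    have := exp_le_exp.2 (by linarith : 2 * t ≤ 2 * T)
    simp only [B]; linarith
  have h1 := mul_le_mul_of_nonneg_right hBt (sq_nonneg (z t))
  have h2 : 0 ≤ z t ^ (p + 1) / (p + 1) := div_nonneg (Real.rpow_nonneg hz.le _) (by linarith)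
  have h3 := sq_nonneg (z' t)
  unfold efEnergy at hE
  have hlow : 2 * c₀ / B ≤ z t ^ 2 := by
    rw [div_le_iff₀ hB]; linarith
  have hup : z t ≤ M₀ := by
    have h4 : z t ^ (p + 1) / (p + 1) ≤ B * z t ^ 2 / 2 := by linarith
    have h5 : z t ^ (p + 1) = z t ^ (p - 1) * z t ^ 2 := by
      rw [← Real.rpow_natCast, ← Real.rpow_add hz]; congr 1; push_cast; ring
    rw [h5, div_le_iff₀ (by linarith)] at h4
    have h6 : z t ^ (p - 1) ≤ (p + 1) * B / 2 := by
      refine le_of_mul_le_mul_right (h4.trans_eq ?_) (by positivity : 0 < z t ^ 2)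
      ring
    have h7 := Real.rpow_le_rpow (Real.rpow_nonneg hz.le _) h6
      (by have : 0 < p - 1 := by linarith
          positivity : 0 ≤ 1 / (p - 1))
    rwa [← Real.rpow_mul hz.le, mul_one_div_cancel (by linarith), Real.rpow_one] at h7
  refine ⟨⟨?_, hup.trans (le_max_left _ _)⟩, le_trans ?_ (le_max_right _ _)⟩
  · rw [← Real.sqrt_sq hz.le]; exact Real.sqrt_le_sqrt hlow
  · refine Real.abs_le_sqrt ?_
    have := mul_le_mul_of_nonneg_left (pow_le_pow_left₀ hz.le hup 2) hB.le
    linarith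

lemma exists_abs_le_on_Icc {f : ℝ → ℝ} (hf : Continuous f) (a b : ℝ) :
    ∃ M, 0 ≤ M ∧ ∀ t ∈ Icc a b, |f t| ≤ M := by
  obtain ⟨M, hM⟩ := isCompact_Icc.exists_bound_of_continuousOn (hf.continuousOn (s := Icc a b))
  exact ⟨max M 0, le_max_right _ _, fun t ht => (hM t ht).trans (le_max_left _ _)⟩

lemma IsEFSol.continuous {b β p : ℝ} {z z' : ℝ → ℝ} (h : IsEFSol b β p z z') : Continuous z :=
  continuous_iff_continuousAt.2 fun t => (h.d1 t).continuousAt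

lemma IsEFSol.continuous_deriv {b β p : ℝ} {z z' : ℝ → ℝ} (h : IsEFSol b β p z z') :
    Continuous z' :=
  continuous_iff_continuousAt.2 fun t => (h.d2 t).continuousAt

set_option maxHeartbeats 1000000 in
/-- Convergence of the regular solutions to a solution tending to the equilibrium at `-∞`, together
with the absence of critical points near the origin. -/
lemma exists_convergence {N : ℕ} (hN : 3 ≤ N) {p θ A : ℝ} (hp : 1 < p)
    (hθ : θ * (p - 1) = 2) (hb : 0 < N - 2 - 2 * θ) (hA : 0 < A)
    (hAβ : A ^ (p - 1) = θ * (N - 2 - θ)) {w w' : ℝ → ℝ}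
    (hw : IsEFSol (N - 2 - 2 * θ) (θ * (N - 2 - θ)) p w w') (hwA : Tendsto w atBot (𝓝 A))
    {U U' U'' : ℝ → ℝ → ℝ} (hU : ∀ γ > (1:ℝ), IsIVPSol N p γ (U γ) (U' γ) (U'' γ)) (t₀ : ℝ) :
    ∃ τ₁ < t₀, (∀ᶠ γ in atTop, ∀ τ ≤ τ₁, U' γ (exp τ) < 0) ∧
      ∀ T, ∀ ε > 0, ∀ᶠ γ in atTop, ∀ t ∈ Icc τ₁ T, |efVar θ (U γ) t - w t| < ε ∧
        |efVarDeriv θ (U γ) (U' γ) t - w' t| < ε := by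
  have hθ0 : 0 < θ := by nlinarith
  have hβ : 0 < θ * (N - 2 - θ) := mul_pos hθ0 (by linarith)
  set b := (N:ℝ) - 2 - 2 * θ with hbdef
  set β := θ * ((N:ℝ) - 2 - θ) with hβdef
  set κ := min 1 (θ / 4)
  have hκ : 0 < κ := lt_min one_pos (by positivity)
  have hκ1 : κ ≤ 1 := min_le_left _ _
  have hκ4 : κ ≤ θ / 4 := min_le_right _ _
  have hκsq : κ ^ 2 ≤ κ := by nlinarith
  set c₀ := b * θ / 32 * exp (2 * θ * Real.log κ)
  have hc₀ : 0 < c₀ := by positivity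
  have henergy : ∀ γ > (2:ℝ), ∀ τ ≥ Real.log κ - Real.log γ / θ,
      efEnergy β p (efVar θ (U γ)) (efVarDeriv θ (U γ) (U' γ)) τ ≤ -c₀ ∧ 0 < efVar θ (U γ) τ :=
    fun γ hγ => (hU γ (by linarith)).energy_and_pos hN hp hθ hb hκ (by linarith) (by linarith) hγ
  obtain ⟨c, hc, M, hM, hbd⟩ := exists_bounds_of_energy hβ hp hc₀ 0
  obtain ⟨r, hr, τ₀, C, hC, hstab⟩ := exists_stability_const hb hβ hp hAβ
  have hw'0 := hw.tendsto_deriv hA hAβ hwA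
  have hwnear : ∀ ε > 0, ∃ s, ∀ t ≤ s, |w t - A| < ε ∧ |w' t| < ε := by
    intro ε hε
    have h1 := (Metric.tendsto_nhds.1 hwA ε hε).and (Metric.tendsto_nhds.1 hw'0 ε hε)
    obtain ⟨s, hs⟩ := eventually_atBot.1 h1
    exact ⟨s, fun t ht => by simpa [Real.dist_eq] using hs t ht⟩
  obtain ⟨τw, hτw⟩ := hwnear r hr
  set τ₁ := min (min τ₀ τw) (min (min 0 (t₀ - 1)) (Real.log c / θ - 1))
  have h1 : τ₁ ≤ τ₀ := (min_le_left _ _).trans (min_le_left _ _)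
  have h2 : τ₁ ≤ τw := (min_le_left _ _).trans (min_le_right _ _)
  have h3 : τ₁ ≤ 0 := (min_le_right _ _).trans ((min_le_left _ _).trans (min_le_left _ _))
  have h4 : τ₁ ≤ t₀ - 1 := (min_le_right _ _).trans ((min_le_left _ _).trans (min_le_right _ _))
  have h5 : τ₁ ≤ Real.log c / θ - 1 := (min_le_right _ _).trans (min_le_right _ _)
  refine ⟨τ₁, by linarith, ?_, ?_⟩
  · filter_upwards [eventually_gt_atTop 2] with γ hγ τ hτ
    have hsol := hU γ (by linarith)
    refine hsol.deriv_neg hN hp (S := exp τ₁) (fun s hs => ?_) _ ⟨exp_pos _, exp_le_exp.2 hτ⟩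
    rw [← Real.exp_log hs.1]
    have hs1 : Real.log s ≤ τ₁ := by
      rw [← Real.exp_le_exp, Real.exp_log hs.1]; exact hs.2
    rcases le_or_gt (Real.log s) (Real.log κ - Real.log γ / θ) with hl | hl
    · have := (hsol.initial_stage hN hp hθ hκ (by linarith) (by linarith) hγ _ hl).1
      linarith
    · obtain ⟨e1, e2⟩ := henergy γ hγ _ hl.le
      have e3 := (hbd _ _ _ (hs1.trans h3) e2 e1).1.1
      have e4 : exp (θ * Real.log s) < c := by
        rw [← Real.lt_log_iff_exp_lt hc]
        have e5 : Real.log s ≤ Real.log c / θ - 1 := hs1.trans h5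
        have e6 : θ * (Real.log c / θ - 1) = Real.log c - θ := by field_simp
        nlinarith
      rw [efVar] at e3
      by_contra! hcon
      have := mul_le_mul_of_nonneg_left hcon (exp_pos (θ * Real.log s)).le
      linarith
  · intro T ε hε
    rcases lt_or_ge T τ₁ with hT | hT
    · exact Eventually.of_forall fun γ t ht => absurd (ht.1.trans ht.2) (not_le.2 hT)
    obtain ⟨c', -, M', hM', hbd'⟩ := exists_bounds_of_energy hβ hp hc₀ T
    obtain ⟨Mw, hMw0, hMw⟩ := exists_abs_le_on_Icc hw.continuous τ₁ T
    obtain ⟨C₂, hC₂⟩ := exists_gronwall_const hb hβ hp (max M' Mw) T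
    set D := exp (|C₂| * (T - τ₁))
    have hD : 1 ≤ D := Real.one_le_exp (mul_nonneg (abs_nonneg _) (by linarith))
    set m := min r ε
    have hm : 0 < m := lt_min hr hε
    have hmr : m ≤ r := min_le_left _ _
    have hmε : m ≤ ε := min_le_right _ _
    have hCD : 1 ≤ C * D := by nlinarith
    set η := m / (4 * (C * D)) with hη
    have hηpos : 0 < η := by positivity
    have hηm : C * D * (8 * η ^ 2) < m ^ 2 := by
      have : C * D * (8 * η ^ 2) = m ^ 2 / (2 * (C * D)) := by
        rw [hη]; field_simp; norm_num
      rw [this, div_lt_iff₀ (by linarith)]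
      nlinarith [sq_pos_of_pos hm]
    obtain ⟨τη, hτη⟩ := hwnear η hηpos
    obtain ⟨L, hL⟩ := exists_long_time_near hb hβ hp hA hAβ hc hM hηpos
    set T₀ := min τ₁ τη
    have hT₀1 : T₀ ≤ τ₁ := min_le_left _ _
    have hT₀2 : T₀ ≤ τη := min_le_right _ _
    have hlog : ∀ᶠ γ in atTop, θ * (Real.log κ - T₀ + L) ≤ Real.log γ :=
      Real.tendsto_log_atTop.eventually_ge_atTop _
    filter_upwards [eventually_gt_atTop 2, hlog] with γ hγ hγL
    have hsol := isEFSol_efVar hθ (hU γ (by linarith))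
    have hγL' : Real.log κ - T₀ + L ≤ Real.log γ / θ := by
      rw [le_div_iff₀ hθ0]; linarith
    obtain ⟨s, hs, hs1, hs2⟩ := hL _ _ hsol (Real.log κ - Real.log γ / θ) T₀
      (hT₀1.trans h3) (by linarith) (fun t ht => by
        obtain ⟨e1, e2⟩ := henergy γ hγ t ht.1
        exact hbd _ _ t (ht.2.trans (hT₀1.trans h3)) e2 e1)
    obtain ⟨hs3, hs4⟩ := hτη s (hs.2.trans hT₀2)
    have hd : (efVar θ (U γ) s - w s) ^ 2 + (efVarDeriv θ (U γ) (U' γ) s - w' s) ^ 2 ≤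
        8 * η ^ 2 := by
      rw [abs_lt] at hs1 hs2 hs3 hs4
      have e1 : (efVar θ (U γ) s - w s) ^ 2 ≤ (2 * η) ^ 2 :=
        sq_le_sq' (by linarith) (by linarith)
      have e2 : (efVarDeriv θ (U γ) (U' γ) s - w' s) ^ 2 ≤ (2 * η) ^ 2 :=
        sq_le_sq' (by linarith) (by linarith)
      linarith
    have hsτ₁ : s ≤ τ₁ := hs.2.trans hT₀1
    have hCd : C * ((efVar θ (U γ) s - w s) ^ 2 + (efVarDeriv θ (U γ) (U' γ) s - w' s) ^ 2) ≤
        C * (8 * η ^ 2) := mul_le_mul_of_nonneg_left hd (by linarith)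
    have hC8 : C * (8 * η ^ 2) ≤ C * D * (8 * η ^ 2) := by
      have : 0 ≤ C * (8 * η ^ 2) := by positivity
      nlinarith
    have hst := hstab _ _ _ _ hsol hw s τ₁ hsτ₁ h1
      (fun t ht => (hτw t (ht.trans h2)).1.le)
      (by
        have : m ^ 2 ≤ r ^ 2 := pow_le_pow_left₀ hm.le hmr 2
        linarith) τ₁ (right_mem_Icc.2 hsτ₁)
    intro t ht
    have hgr := (hC₂ _ _ _ _ hsol hw τ₁ T hT le_rfl (fun x hx => by
      obtain ⟨e1, e2⟩ := henergy γ hγ x (hs.1.trans (hsτ₁.trans hx.1))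
      have e3 := (hbd' _ _ x hx.2 e2 e1).1.2
      rw [abs_of_pos e2]
      exact ⟨e3.trans (le_max_left _ _), (hMw x hx).trans (le_max_right _ _)⟩) t ht).1
    have hexp : exp (C₂ * (t - τ₁)) ≤ D := by
      refine exp_le_exp.2 ?_
      have e1 := mul_le_mul_of_nonneg_right (le_abs_self C₂) (by linarith [ht.1] : 0 ≤ t - τ₁)
      have e2 := mul_le_mul_of_nonneg_left (by linarith [ht.2] : t - τ₁ ≤ T - τ₁) (abs_nonneg C₂)
      linarith
    have hfin : (efVar θ (U γ) t - w t) ^ 2 + (efVarDeriv θ (U γ) (U' γ) t - w' t) ^ 2 < ε ^ 2 := by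
      calc _ ≤ _ := hgr
        _ ≤ (C * (8 * η ^ 2)) * D :=
          mul_le_mul (hst.trans hCd) hexp (exp_pos _).le (by positivity)
        _ = C * D * (8 * η ^ 2) := by ring
        _ < m ^ 2 := hηm
        _ ≤ ε ^ 2 := pow_le_pow_left₀ hm.le hmε 2
    constructor
    · refine abs_lt_of_sq_lt_sq ?_ hε.le
      linarith [sq_nonneg (efVarDeriv θ (U γ) (U' γ) t - w' t)]
    · refine abs_lt_of_sq_lt_sq ?_ hε.le
      linarith [sq_nonneg (efVar θ (U γ) t - w t)]

/-- Nondegeneracy of the critical points of the singular solution. -/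
lemma IsEFSol.critical_nondegenerate {b β p θ A : ℝ} {w w' : ℝ → ℝ} (hb : 0 < b) (hβ : 0 < β)
    (hp : 1 < p) (hθ : θ * (p - 1) = 2) (hβθ : β = θ * (b + θ)) (hA : 0 < A)
    (hw : IsEFSol b β p w w') (hwA : Tendsto w atBot (𝓝 A)) {t : ℝ} (h0 : w' t - θ * w t = 0) :
    -b * w' t - w t ^ p + (β + exp (2 * t)) * w t - θ * w' t ≠ 0 := by
  intro h1
  have hθ0 : 0 < θ := by nlinarith
  have hw' : w' t = θ * w t := by linarith
  have hwp : w t ^ p = exp (2 * t) * w t := by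
    rw [hw', hβθ] at h1; linarith
  set c := exp (-(θ * t)) * w t with hc
  have hcp : c ^ p = c := by
    rw [hc, mul_rpow_of_pos (exp_pos _), hwp, ← Real.exp_mul, ← mul_assoc, ← Real.exp_add]
    congr 2
    linear_combination (-t) * hθ
  have hvt : exp (θ * t) * c = w t := by
    rw [hc, ← mul_assoc, ← Real.exp_add]; simp
  clear_value c
  have hexpθ : ∀ τ, HasDerivAt (fun t : ℝ => exp (θ * t) * c) (θ * (exp (θ * τ) * c)) τ :=
    fun τ => by
    have h1 : HasDerivAt (fun x : ℝ => θ * x) θ τ := by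
      simpa using (hasDerivAt_id τ).const_mul θ
    exact (h1.exp.mul_const c).congr_deriv (by ring)
  have hv : IsEFSol b β p (fun τ => exp (θ * τ) * c) (fun τ => θ * (exp (θ * τ) * c)) := by
    refine ⟨hexpθ, fun τ => ((hexpθ τ).const_mul θ).congr_deriv ?_⟩
    have : (exp (θ * τ) * c) ^ p = exp (2 * τ) * (exp (θ * τ) * c) := by
      rw [mul_rpow_of_pos (exp_pos _), hcp, ← Real.exp_mul, ← mul_assoc, ← Real.exp_add]
      congr 2
      linear_combination τ * hθ
    rw [this, hβθ]
    ring
  have heq : ∀ s ≤ t, exp (θ * s) * c = w s := by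
    intro s hs
    obtain ⟨M₁, -, hM₁⟩ := exists_abs_le_on_Icc hw.continuous s t
    obtain ⟨M₂, -, hM₂⟩ := exists_abs_le_on_Icc hv.continuous s t
    obtain ⟨C, hC⟩ := exists_gronwall_const hb hβ hp (max M₁ M₂) t
    have := (hC _ _ _ _ hv hw s t hs le_rfl (fun x hx =>
      ⟨(hM₂ x hx).trans (le_max_right _ _), (hM₁ x hx).trans (le_max_left _ _)⟩) s
      (left_mem_Icc.2 hs)).2
    rw [hvt, hw'] at this
    simp only [sub_self, ne_eq, OfNat.ofNat_ne_zero, not_false_eq_true, zero_pow, add_zero,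
      zero_mul] at this
    have h2 : (exp (θ * s) * c - w s) ^ 2 = 0 :=
      le_antisymm (by linarith [sq_nonneg (θ * (exp (θ * s) * c) - w' s)]) (sq_nonneg _)
    have := pow_eq_zero_iff two_ne_zero |>.1 h2
    linarith
  have hlim : Tendsto w atBot (𝓝 (0 * c)) := by
    have h2 : Tendsto (fun τ : ℝ => exp (θ * τ) * c) atBot (𝓝 (0 * c)) :=
      (Real.tendsto_exp_atBot.comp (tendsto_id.const_mul_atBot hθ0)).mul_const c
    refine h2.congr' ?_
    filter_upwards [eventually_le_atBot t] with s hs using heq s hs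
  have := tendsto_nhds_unique hwA hlim
  rw [zero_mul] at this
  linarith

lemma eventually_existsUnique_zero_of_deriv_pos {ι : Type*} {l : Filter ι} {f f' : ι → ℝ → ℝ}
    {g g' : ℝ → ℝ} {a τ₁ : ℝ} (hf : ∀ᶠ γ in l, ∀ t, HasDerivAt (f γ) (f' γ t) t)
    (hg : ∀ t, HasDerivAt g (g' t) t) (hg'c : ContinuousAt g' a) (hga : g a = 0)
    (hg'a : 0 < g' a) (hτ₁ : τ₁ < a)
    (hconv : ∀ T, ∀ ε > 0, ∀ᶠ γ in l, ∀ t ∈ Icc τ₁ T, |f γ t - g t| < ε ∧ |f' γ t - g' t| < ε) :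
    ∃ δ₀ > 0, ∀ δ > 0, δ ≤ δ₀ → ∀ᶠ γ in l, ∃ S ∈ Icc (a - δ) (a + δ), f γ S = 0 ∧
      ∀ t ∈ Icc (a - δ) (a + δ), f γ t = 0 → t = S := by
  obtain ⟨δ₁, hδ₁, hball⟩ := Metric.continuousAt_iff.1 hg'c (g' a / 2) (by positivity)
  refine ⟨min (δ₁ / 2) (a - τ₁), lt_min (by positivity) (by linarith), fun δ hδ hδle => ?_⟩
  have hδ1 : δ ≤ δ₁ / 2 := hδle.trans (min_le_left _ _)
  have hδ2 : δ ≤ a - τ₁ := hδle.trans (min_le_right _ _)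
  have hg'pos : ∀ t ∈ Icc (a - δ) (a + δ), g' a / 2 < g' t := by
    intro t ht
    have := hball (x := t) (by
      rw [Real.dist_eq, abs_lt]; constructor <;> linarith [ht.1, ht.2])
    rw [Real.dist_eq, abs_lt] at this
    linarith
  have hgmono : StrictMonoOn g (Icc (a - δ) (a + δ)) :=
    strictMonoOn_of_hasDerivWithinAt_pos (convex_Icc _ _)
      (fun t _ => (hg t).continuousAt.continuousWithinAt) (fun t _ => (hg t).hasDerivWithinAt)
      (fun t ht => by linarith [hg'pos t (interior_subset ht)])
  have hl : a - δ ∈ Icc (a - δ) (a + δ) := ⟨le_rfl, by linarith⟩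
  have hr : a + δ ∈ Icc (a - δ) (a + δ) := ⟨by linarith, le_rfl⟩
  have hm : a ∈ Icc (a - δ) (a + δ) := ⟨by linarith, by linarith⟩
  have hgl : g (a - δ) < 0 := hga ▸ hgmono hl hm (by linarith)
  have hgr : 0 < g (a + δ) := hga ▸ hgmono hm hr (by linarith)
  filter_upwards [hf, hconv (a + δ) (min (g' a / 2) (min (-g (a - δ)) (g (a + δ))))
    (lt_min (by positivity) (lt_min (by linarith) hgr))] with γ hfγ hcγ
  have hcl := abs_lt.1 ((hcγ (a - δ) ⟨by linarith, by linarith⟩).1.trans_le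
    ((min_le_right _ _).trans (min_le_left _ _)))
  have hcr := abs_lt.1 ((hcγ (a + δ) ⟨by linarith, by linarith⟩).1.trans_le
    ((min_le_right _ _).trans (min_le_right _ _)))
  obtain ⟨S, hS, hS0⟩ := intermediate_value_Icc (f := f γ) (by linarith : a - δ ≤ a + δ)
    (fun t _ => (hfγ t).continuousAt.continuousWithinAt)
    (⟨by linarith, by linarith⟩ : (0:ℝ) ∈ Icc _ _)
  refine ⟨S, hS, hS0, fun t ht ht0 => ?_⟩
  have hfmono : StrictMonoOn (f γ) (Icc (a - δ) (a + δ)) :=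
    strictMonoOn_of_hasDerivWithinAt_pos (convex_Icc _ _)
      (fun t _ => (hfγ t).continuousAt.continuousWithinAt) (fun t _ => (hfγ t).hasDerivWithinAt)
      (fun t ht => by
        have ht' := interior_subset ht
        have h1 := abs_lt.1 ((hcγ t ⟨by linarith [ht'.1], ht'.2⟩).2.trans_le (min_le_left _ _))
        linarith [hg'pos t ht'])
  exact hfmono.injOn ht hS (ht0.trans hS0.symm)

lemma eventually_existsUnique_zero {ι : Type*} {l : Filter ι} {f f' : ι → ℝ → ℝ}
    {g g' : ℝ → ℝ} {a τ₁ : ℝ} (hf : ∀ᶠ γ in l, ∀ t, HasDerivAt (f γ) (f' γ t) t)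
    (hg : ∀ t, HasDerivAt g (g' t) t) (hg'c : ContinuousAt g' a) (hga : g a = 0)
    (hg'a : g' a ≠ 0) (hτ₁ : τ₁ < a)
    (hconv : ∀ T, ∀ ε > 0, ∀ᶠ γ in l, ∀ t ∈ Icc τ₁ T, |f γ t - g t| < ε ∧ |f' γ t - g' t| < ε) :
    ∃ δ₀ > 0, ∀ δ > 0, δ ≤ δ₀ → ∀ᶠ γ in l, ∃ S ∈ Icc (a - δ) (a + δ), f γ S = 0 ∧
      ∀ t ∈ Icc (a - δ) (a + δ), f γ t = 0 → t = S := by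
  rcases hg'a.lt_or_gt with hneg | hpos
  · have h := eventually_existsUnique_zero_of_deriv_pos (f := fun γ t => -f γ t)
      (f' := fun γ t => -f' γ t) (g := fun t => -g t) (g' := fun t => -g' t) (a := a) (τ₁ := τ₁)
      (hf.mono fun γ h t => (h t).neg) (fun t => (hg t).neg) hg'c.neg (by simpa using hga)
      (by simpa using hneg) hτ₁ (fun T ε hε => (hconv T ε hε).mono fun γ h t ht => by
        rw [← neg_sub', ← neg_sub', abs_neg, abs_neg]; exact h t ht)
    simpa using h
  · exact eventually_existsUnique_zero_of_deriv_pos hf hg hg'c hga hpos hτ₁ hconv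

lemma eventually_ne_zero_on_Icc {ι : Type*} {l : Filter ι} {f : ι → ℝ → ℝ} {g : ℝ → ℝ}
    {x y τ₁ : ℝ} (hg : Continuous g) (hx : τ₁ ≤ x) (hne : ∀ t ∈ Icc x y, g t ≠ 0)
    (hconv : ∀ T, ∀ ε > 0, ∀ᶠ γ in l, ∀ t ∈ Icc τ₁ T, |f γ t - g t| < ε) :
    ∀ᶠ γ in l, ∀ t ∈ Icc x y, f γ t ≠ 0 := by
  rcases (Icc x y).eq_empty_or_nonempty with hE | hN
  · exact Eventually.of_forall fun γ t ht => by rw [hE] at ht; exact ht.elim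
  obtain ⟨x₀, hx₀, hmin⟩ := isCompact_Icc.exists_isMinOn hN hg.abs.continuousOn
  filter_upwards [hconv y |g x₀| (abs_pos.2 (hne x₀ hx₀))] with γ hγ t ht h0
  have h1 := hγ t ⟨hx.trans ht.1, ht.2⟩
  have h2 : |g x₀| ≤ |g t| := hmin ht
  rw [h0, zero_sub, abs_neg] at h1
  linarith

/-- If `f γ → g` locally in `C¹` on `[τ₁, ∞)`, `f γ` has no zero in `(-∞, τ₁]` and the zeros of `g`
are simple and form an increasing sequence `a`, then the `n`-th zero of `f γ` tends to `a n`. -/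
lemma eventually_nth_zero {ι : Type*} {l : Filter ι} {f f' : ι → ℝ → ℝ}
    {g g' : ℝ → ℝ} {a : ℕ → ℝ} {τ₁ : ℝ} (hf : ∀ᶠ γ in l, ∀ t, HasDerivAt (f γ) (f' γ t) t)
    (hg : ∀ t, HasDerivAt g (g' t) t) (hg'c : Continuous g') (ha : StrictMono a)
    (hzero : ∀ t, g t = 0 ↔ ∃ k, a k = t) (hsimple : ∀ t, g t = 0 → g' t ≠ 0) (hτ₁ : τ₁ < a 0)
    (hne : ∀ᶠ γ in l, ∀ t ≤ τ₁, f γ t ≠ 0)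
    (hconv : ∀ T, ∀ ε > 0, ∀ᶠ γ in l, ∀ t ∈ Icc τ₁ T, |f γ t - g t| < ε ∧ |f' γ t - g' t| < ε)
    (n : ℕ) :
    ∃ δ₀ > 0, ∀ δ > 0, δ ≤ δ₀ → ∀ᶠ γ in l, ∃ S ∈ Icc (a n - δ) (a n + δ), f γ S = 0 ∧
      {t | t < S ∧ f γ t = 0}.encard = n ∧ ∀ t, S < t → t ≤ a n + δ → f γ t ≠ 0 := by
  have hgc : Continuous g := continuous_iff_continuousAt.2 fun t => (hg t).continuousAt
  have hconv₀ : ∀ T, ∀ ε > 0, ∀ᶠ γ in l, ∀ t ∈ Icc τ₁ T, |f γ t - g t| < ε :=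
    fun T ε hε => (hconv T ε hε).mono fun γ h t ht => (h t ht).1
  have hloc : ∀ k, ∃ δ₀ > 0, ∀ δ > 0, δ ≤ δ₀ → ∀ᶠ γ in l, ∃ S ∈ Icc (a k - δ) (a k + δ),
      f γ S = 0 ∧ ∀ t ∈ Icc (a k - δ) (a k + δ), f γ t = 0 → t = S := fun k =>
    eventually_existsUnique_zero hf hg hg'c.continuousAt ((hzero _).2 ⟨k, rfl⟩)
      (hsimple _ ((hzero _).2 ⟨k, rfl⟩)) (hτ₁.trans_le (ha.monotone k.zero_le)) hconv
  induction n with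
  | zero =>
    obtain ⟨δ₁, hδ₁, h⟩ := hloc 0
    refine ⟨δ₁, hδ₁, fun δ hδ hδle => ?_⟩
    have hgap : ∀ t ∈ Icc τ₁ (a 0 - δ), g t ≠ 0 := by
      intro t ht h0
      obtain ⟨k, rfl⟩ := (hzero t).1 h0
      have := ha.monotone k.zero_le
      linarith [ht.2]
    filter_upwards [h δ hδ hδle, hne, eventually_ne_zero_on_Icc hgc le_rfl hgap hconv₀]
      with γ ⟨S, hS, hS0, huniq⟩ h1 h2
    refine ⟨S, hS, hS0, ?_, fun t ht ht' ht0 =>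
      ht.ne' (huniq t ⟨hS.1.trans ht.le, ht'⟩ ht0)⟩
    rw [Nat.cast_zero, Set.encard_eq_zero, Set.eq_empty_iff_forall_notMem]
    rintro t ⟨htS, ht0⟩
    rcases le_total t τ₁ with h3 | h3
    · exact h1 t h3 ht0
    rcases le_total t (a 0 - δ) with h4 | h4
    · exact h2 t ⟨h3, h4⟩ ht0
    · exact htS.ne (huniq t ⟨h4, htS.le.trans hS.2⟩ ht0)
  | succ n ih =>
    obtain ⟨δ₁, hδ₁, h⟩ := hloc (n + 1)
    obtain ⟨δ₂, hδ₂, ih⟩ := ih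
    have hlt : a n < a (n + 1) := ha n.lt_succ_self
    set d := min δ₂ ((a (n + 1) - a n) / 4)
    have hd : 0 < d := lt_min hδ₂ (by linarith)
    have hd4 : d ≤ (a (n + 1) - a n) / 4 := min_le_right _ _
    refine ⟨min δ₁ ((a (n + 1) - a n) / 2), lt_min hδ₁ (by linarith), fun δ hδ hδle => ?_⟩
    have hδ1 : δ ≤ δ₁ := hδle.trans (min_le_left _ _)
    have hδ2 : δ ≤ (a (n + 1) - a n) / 2 := hδle.trans (min_le_right _ _)
    have hgap : ∀ t ∈ Icc (a n + d) (a (n + 1) - δ), g t ≠ 0 := by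
      intro t ht h0
      obtain ⟨k, rfl⟩ := (hzero t).1 h0
      have h1 : n < k := ha.lt_iff_lt.1 (by linarith [ht.1])
      have h2 : k < n + 1 := ha.lt_iff_lt.1 (by linarith [ht.2])
      omega
    have hτn : τ₁ ≤ a n + d := by linarith [ha.monotone n.zero_le]
    filter_upwards [h δ hδ hδ1, ih d hd (min_le_left _ _),
      eventually_ne_zero_on_Icc hgc hτn hgap hconv₀]
      with γ ⟨S, hS, hS0, huniq⟩ ⟨R, hR, hR0, hcard, hafter⟩ h2
    refine ⟨S, hS, hS0, ?_, fun t ht ht' ht0 =>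
      ht.ne' (huniq t ⟨hS.1.trans ht.le, ht'⟩ ht0)⟩
    have hRS : R < S := by linarith [hR.2, hS.1]
    have hset : {t | t < S ∧ f γ t = 0} = insert R {t | t < R ∧ f γ t = 0} := by
      ext t
      simp only [mem_ofPred_eq, mem_insert_iff]
      constructor
      · rintro ⟨htS, ht0⟩
        rcases lt_trichotomy t R with h3 | h3 | h3
        · exact Or.inr ⟨h3, ht0⟩
        · exact Or.inl h3
        · exfalso
          rcases le_total t (a n + d) with h4 | h4
          · exact hafter t h3 h4 ht0
          rcases le_total t (a (n + 1) - δ) with h5 | h5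
          · exact h2 t ⟨h4, h5⟩ ht0
          · exact htS.ne (huniq t ⟨h5, htS.le.trans hS.2⟩ ht0)
      · rintro (rfl | ⟨h3, h4⟩)
        · exact ⟨hRS, hR0⟩
        · exact ⟨h3.trans hRS, h4⟩
    rw [hset, Set.encard_insert_of_notMem (fun hm => lt_irrefl _ hm.1), hcard]
    push_cast
    rfl

lemma two_mul_thetaP_lt_of_pSob_lt {N : ℕ} (hN : 3 ≤ N) {p : ℝ} (hp : 1 < p) (hpS : pSob N < p) :
    0 < (N : ℝ) - 2 - 2 * thetaP p := by
  have hN' : (3:ℝ) ≤ N := by exact_mod_cast hN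
  have h2 : (0:ℝ) < N - 2 := by linarith
  have h1 : 0 < p - 1 := by linarith
  rw [pSob, div_lt_iff₀ h2] at hpS
  have : (N : ℝ) - 2 - 2 * thetaP p = (((N:ℝ) - 2) * (p - 1) - 4) / (p - 1) := by
    rw [thetaP]; field_simp; ring
  rw [this]
  exact div_pos (by linarith) h1

/-- The singular solution in Emden-Fowler variables. -/
lemma IsEntireSingODE.isEFSol {N : ℕ} {p β : ℝ} {y y' y'' : ℝ → ℝ} (hp : 1 < p)
    (hβdef : β = thetaP p * ((N : ℝ) - 2 - thetaP p)) (hβ : 0 < β)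
    (h : IsEntireSingODE N p y y' y'') :
    0 < Aconst N p ∧ Aconst N p ^ (p - 1) = β ∧
      IsEFSol (N - 2 - 2 * thetaP p) β p (fun τ => Aconst N p * y (τ / mConst N p))
        (fun τ => Aconst N p / mConst N p * y' (τ / mConst N p)) ∧
      Tendsto (fun τ => Aconst N p * y (τ / mConst N p)) atBot (𝓝 (Aconst N p)) := by
  obtain ⟨h1, h2, -, h3, h4⟩ := h
  have hp1 : 0 < p - 1 := by linarith
  have hAeq : Aconst N p = β ^ (1 / (p - 1)) := by rw [Aconst, hβdef]
  have hmeq : mConst N p = β ^ (-(1 / 2) : ℝ) := by rw [mConst, hβdef]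
  have hA : 0 < Aconst N p := by rw [hAeq]; positivity
  have hm : 0 < mConst N p := by rw [hmeq]; positivity
  have hAp : Aconst N p ^ (p - 1) = β := by
    rw [hAeq, ← Real.rpow_mul hβ.le, one_div_mul_cancel hp1.ne', Real.rpow_one]
  have hm2 : β * mConst N p ^ 2 = 1 := by
    rw [hmeq, ← Real.rpow_natCast, ← Real.rpow_mul hβ.le]
    norm_num
    rw [Real.rpow_neg_one, mul_inv_cancel₀ hβ.ne']
  have hAp' : Aconst N p ^ p = β * Aconst N p := by
    rw [← hAp, ← Real.rpow_add_one hA.ne']; simp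
  have hα : alphaConst N p = mConst N p * ((N : ℝ) - 2 - 2 * thetaP p) := rfl
  rw [hα] at h3
  generalize Aconst N p = A at *
  generalize mConst N p = m at *
  have hdiv : ∀ τ : ℝ, HasDerivAt (fun τ => τ / m) (1 / m) τ := fun τ =>
    (hasDerivAt_id τ).div_const m
  refine ⟨hA, hAp, ⟨fun τ => ?_, fun τ => ?_⟩, ?_⟩
  · exact (((h1 _).comp τ (hdiv τ)).const_mul A).congr_deriv (by ring)
  · refine (((h2 _).comp τ (hdiv τ)).const_mul (A / m)).congr_deriv ?_
    have e := h3 (τ / m)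
    rw [show 2 * m * (τ / m) = 2 * τ by field_simp] at e
    rw [mul_rpow_of_pos hA, hAp']
    generalize y (τ / m) ^ p = Y at *
    have hβm : β = 1 / m ^ 2 := by rw [eq_div_iff (by positivity)]; exact hm2
    have e' : y'' (τ / m) = -(m * ((N : ℝ) - 2 - 2 * thetaP p) * y' (τ / m)) + y (τ / m) - Y +
      m ^ 2 * exp (2 * τ) * y (τ / m) := by linarith
    rw [e', hβm]
    field_simp
    ring
  · simpa using (h4.comp (tendsto_id.atBot_div_const hm)).const_mul A

lemma deriv_ustar {N : ℕ} {p t : ℝ} {y y' : ℝ → ℝ} (h1 : ∀ t, HasDerivAt y (y' t) t) :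
    deriv (ustar N p y) (exp t) = exp t ^ (-thetaP p - 1) *
      (Aconst N p / mConst N p * y' (t / mConst N p) -
        thetaP p * (Aconst N p * y (t / mConst N p))) := by
  have hx := exp_pos t
  have e1 : HasDerivAt (fun s : ℝ => s ^ (-thetaP p)) (-thetaP p * exp t ^ (-thetaP p - 1))
      (exp t) := Real.hasDerivAt_rpow_const (Or.inl hx.ne')
  have e2 := (h1 (Real.log (exp t) / mConst N p)).comp (exp t)
    ((Real.hasDerivAt_log hx.ne').div_const (mConst N p))
  have e3 : HasDerivAt (ustar N p y) _ (exp t) := (e1.const_mul (Aconst N p)).mul e2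
  rw [e3.deriv]
  simp only [Real.log_exp]
  have e4 : exp t ^ (-thetaP p) = exp t ^ (-thetaP p - 1) * exp t := by
    rw [← Real.rpow_add_one hx.ne']; simp
  rw [e4]
  field_simp
  ring

/-- Convergence of `z' - θ z` and its derivative follows from that of `z` and `z'`. -/
lemma IsEFSol.eventually_near {ι : Type*} {l : Filter ι} {b β p θ τ₁ : ℝ} {w w' : ℝ → ℝ}
    {z z' : ι → ℝ → ℝ} (hp : 1 < p) (hw : IsEFSol b β p w w')
    (hconv : ∀ T, ∀ ε > 0, ∀ᶠ γ in l, ∀ t ∈ Icc τ₁ T, |z γ t - w t| < ε ∧ |z' γ t - w' t| < ε)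
    (T : ℝ) {ε : ℝ} (hε : 0 < ε) :
    ∀ᶠ γ in l, ∀ t ∈ Icc τ₁ T, |z' γ t - θ * z γ t - (w' t - θ * w t)| < ε ∧
      |(-b * z' γ t - z γ t ^ p + (β + exp (2 * t)) * z γ t - θ * z' γ t) -
        (-b * w' t - w t ^ p + (β + exp (2 * t)) * w t - θ * w' t)| < ε := by
  obtain ⟨M, hM0, hM⟩ := exists_abs_le_on_Icc hw.continuous τ₁ T
  set P := p * (M + 1) ^ (p - 1)
  have hP : 0 ≤ P := by positivity
  set K := 1 + |θ| + |b| + P + |β| + exp (2 * T) with hK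
  have hK0 : 0 < K := by positivity
  have hδ : 0 < min 1 (ε / (2 * K)) := lt_min one_pos (by positivity)
  filter_upwards [hconv T _ hδ] with γ hγ t ht
  set δ := min 1 (ε / (2 * K))
  have hδ1 : δ ≤ 1 := min_le_left _ _
  have hKδ : K * δ < ε := by
    have : K * δ ≤ K * (ε / (2 * K)) := mul_le_mul_of_nonneg_left (min_le_right _ _) hK0.le
    have h2 : K * (ε / (2 * K)) = ε / 2 := by field_simp
    linarith
  obtain ⟨h1, h2⟩ := hγ t ht
  have hMt := hM t ht
  have hz : |z γ t| ≤ M + 1 := by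
    have := abs_add_le (z γ t - w t) (w t)
    rw [sub_add_cancel] at this
    linarith
  have hpow := abs_rpow_sub_rpow_le hp hz (hMt.trans (by linarith))
  have hexp : exp (2 * t) ≤ exp (2 * T) := exp_le_exp.2 (by linarith [ht.2])
  have hmul : ∀ c x : ℝ, |x| < δ → |c * x| ≤ |c| * δ := fun c x hx => by
    rw [abs_mul]; exact mul_le_mul_of_nonneg_left hx.le (abs_nonneg _)
  have a1 := hmul θ _ h1
  have a2 := hmul θ _ h2
  have a3 := hmul b _ h2
  have a4 := hmul β _ h1
  have a5 : |exp (2 * t) * (z γ t - w t)| ≤ exp (2 * T) * δ := by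
    refine (hmul _ _ h1).trans ?_
    rw [abs_of_pos (exp_pos _)]
    exact mul_le_mul_of_nonneg_right hexp hδ.le
  have a6 : |z γ t ^ p - w t ^ p| ≤ P * δ :=
    hpow.trans (mul_le_mul_of_nonneg_left h1.le hP)
  have hKexp : K * δ = δ + |θ| * δ + |b| * δ + P * δ + |β| * δ + exp (2 * T) * δ := by
    rw [hK]; ring
  have n1 : 0 ≤ |b| * δ := by positivity
  have n2 : 0 ≤ P * δ := by positivity
  have n3 : 0 ≤ |β| * δ := by positivity
  have n4 : 0 ≤ exp (2 * T) * δ := by positivity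
  rw [abs_lt] at h1 h2
  rw [abs_le] at a1 a2 a3 a4 a5 a6
  obtain ⟨h2l, h2r⟩ := h2
  obtain ⟨a1l, a1r⟩ := a1
  obtain ⟨a2l, a2r⟩ := a2
  obtain ⟨a3l, a3r⟩ := a3
  obtain ⟨a4l, a4r⟩ := a4
  obtain ⟨a5l, a5r⟩ := a5
  obtain ⟨a6l, a6r⟩ := a6
  rw [abs_lt, abs_lt]
  refine ⟨⟨?_, ?_⟩, ?_, ?_⟩ <;> linarith

lemma isNthCritPt_exp {u' : ℝ → ℝ} {n : ℕ} {S : ℝ} (h0 : u' (exp S) = 0)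
    (hS : {t | t < S ∧ u' (exp t) = 0}.encard = n) : IsNthCritPt u' n (exp S) := by
  refine ⟨exp_pos S, h0, ?_⟩
  suffices himage : {x : ℝ | 0 < x ∧ x < exp S ∧ u' x = 0} =
      exp '' {t | t < S ∧ u' (exp t) = 0} by
    rw [himage, exp_injective.encard_image, hS]
  ext x
  constructor
  · rintro ⟨h1, h2, h3⟩
    refine ⟨Real.log x, ⟨?_, ?_⟩, Real.exp_log h1⟩
    · rwa [Real.log_lt_iff_lt_exp h1]
    · rwa [Real.exp_log h1]
  · rintro ⟨t, ⟨h1, h2⟩, rfl⟩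
    exact ⟨exp_pos t, exp_lt_exp.2 h1, h2⟩

lemma IsNthCritPt.le {u' : ℝ → ℝ} {n : ℕ} {s s' : ℝ} (h : IsNthCritPt u' n s)
    (h' : IsNthCritPt u' n s') : s' ≤ s := by
  by_contra! hlt
  have hsub : insert s {x : ℝ | 0 < x ∧ x < s ∧ u' x = 0} ⊆
      {x : ℝ | 0 < x ∧ x < s' ∧ u' x = 0} := by
    rintro x (rfl | hx)
    · exact ⟨h.1, hlt, h.2.1⟩
    · exact ⟨hx.1, hx.2.1.trans hlt, hx.2.2⟩
  have hle := encard_le_encard hsub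
  rw [encard_insert_of_notMem (fun hx => lt_irrefl _ hx.2.1), h.2.2, h'.2.2] at hle
  have : n + 1 ≤ n := by exact_mod_cast hle
  omega

lemma IsNthCritPt.unique {u' : ℝ → ℝ} {n : ℕ} {s s' : ℝ} (h : IsNthCritPt u' n s)
    (h' : IsNthCritPt u' n s') : s = s' :=
  le_antisymm (h'.le h) (h.le h')

/-- Near each critical point of the singular solution lies the corresponding critical point of the
regular solutions with large initial value. -/
lemma eventually_exists_isNthCritPt {N : ℕ} (hN : 3 ≤ N) {p : ℝ} (hp : 1 < p)
    (hpS : pSob N < p) {ys ys' ys'' : ℝ → ℝ} (hys : IsEntireSingODE N p ys ys' ys'')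
    {sstar : ℕ → ℝ} (hsm : StrictMono sstar) (hspos : ∀ k, 0 < sstar k)
    (hschar : ∀ x : ℝ, 0 < x → (deriv (ustar N p ys) x = 0 ↔ ∃ k, sstar k = x))
    {U U' U'' : ℝ → ℝ → ℝ} (hU : ∀ γ > (1:ℝ), IsIVPSol N p γ (U γ) (U' γ) (U'' γ)) (n : ℕ) :
    ∃ δ₀ > 0, ∀ δ > 0, δ ≤ δ₀ → ∀ᶠ γ in atTop, ∃ t, |t - Real.log (sstar n)| ≤ δ ∧
      IsNthCritPt (U' γ) n (exp t) := by
  have hb := two_mul_thetaP_lt_of_pSob_lt hN hp hpS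
  have hp1 : 0 < p - 1 := by linarith
  have hθ : thetaP p * (p - 1) = 2 := by rw [thetaP]; field_simp
  have hθ0 : 0 < thetaP p := div_pos two_pos hp1
  have hβ : 0 < thetaP p * ((N : ℝ) - 2 - thetaP p) := mul_pos hθ0 (by linarith)
  obtain ⟨hA, hAβ, hw, hwA⟩ := hys.isEFSol hp rfl hβ
  have hder : ∀ t, deriv (ustar N p ys) (exp t) = exp t ^ (-thetaP p - 1) *
      (Aconst N p / mConst N p * ys' (t / mConst N p) -
        thetaP p * (Aconst N p * ys (t / mConst N p))) := fun t => deriv_ustar hys.1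
  generalize thetaP p = θ at *
  generalize Aconst N p = A at *
  set w := fun τ => A * ys (τ / mConst N p)
  set w' := fun τ => A / mConst N p * ys' (τ / mConst N p)
  have hg : ∀ t, HasDerivAt (fun t => w' t - θ * w t)
      (-((N : ℝ) - 2 - 2 * θ) * w' t - w t ^ p + (θ * (N - 2 - θ) + exp (2 * t)) * w t -
        θ * w' t) t := fun t => (hw.d2 t).sub ((hw.d1 t).const_mul θ)
  have hgc : Continuous fun t => -((N : ℝ) - 2 - 2 * θ) * w' t - w t ^ p +
      (θ * (N - 2 - θ) + exp (2 * t)) * w t - θ * w' t := by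
    have c1 := hw.continuous
    have c2 := hw.continuous_deriv
    have c3 : Continuous fun t => w t ^ p := c1.rpow_const fun _ => Or.inr (by linarith)
    fun_prop
  have ha : StrictMono fun k => Real.log (sstar k) := fun i j hij =>
    Real.log_lt_log (hspos i) (hsm hij)
  have hzero : ∀ t, w' t - θ * w t = 0 ↔ ∃ k, Real.log (sstar k) = t := by
    intro t
    have h1 := hschar _ (exp_pos t)
    have h2 : exp t ^ (-θ - 1) ≠ 0 := by positivity
    rw [hder, mul_eq_zero, or_iff_right h2] at h1
    refine h1.trans (exists_congr fun k => ?_)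
    constructor
    · intro h; rw [h, Real.log_exp]
    · rintro rfl; rw [Real.exp_log (hspos k)]
  have hsimple := fun t (ht : w' t - θ * w t = 0) =>
    hw.critical_nondegenerate hb hβ hp hθ (by ring) hA hwA ht
  obtain ⟨τ₁, hτ₁, hneg, hconv⟩ :=
    exists_convergence hN hp hθ hb hA hAβ hw hwA hU (Real.log (sstar 0))
  have hval : ∀ γ t, efVarDeriv θ (U γ) (U' γ) t - θ * efVar θ (U γ) t = 0 ↔
      U' γ (exp t) = 0 := by
    intro γ t
    have h1 : efVarDeriv θ (U γ) (U' γ) t - θ * efVar θ (U γ) t =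
        exp (θ * t) * exp t * U' γ (exp t) := by rw [efVar, efVarDeriv]; ring
    rw [h1, mul_eq_zero, or_iff_right (by positivity)]
  obtain ⟨δ₀, hδ₀, h⟩ := eventually_nth_zero
    (f := fun γ t => efVarDeriv θ (U γ) (U' γ) t - θ * efVar θ (U γ) t)
    (f' := fun γ t => -((N : ℝ) - 2 - 2 * θ) * efVarDeriv θ (U γ) (U' γ) t -
      efVar θ (U γ) t ^ p + (θ * (N - 2 - θ) + exp (2 * t)) * efVar θ (U γ) t -
        θ * efVarDeriv θ (U γ) (U' γ) t)
    (by
      filter_upwards [eventually_gt_atTop 1] with γ hγ t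
      have hz := isEFSol_efVar hθ (hU γ hγ)
      exact (hz.d2 t).sub ((hz.d1 t).const_mul θ))
    hg hgc ha hzero hsimple hτ₁
    (by
      filter_upwards [hneg] with γ hγ t ht
      rw [ne_eq, hval]
      exact (hγ t ht).ne)
    (fun T ε hε => hw.eventually_near hp hconv T hε) n
  refine ⟨δ₀, hδ₀, fun δ hδ hδ' => ?_⟩
  filter_upwards [h δ hδ hδ'] with γ hγ
  obtain ⟨t, ht, h1, h2, -⟩ := hγ
  simp only [hval] at h1 h2
  exact ⟨t, abs_le.2 ⟨by linarith [ht.1], by linarith [ht.2]⟩, isNthCritPt_exp h1 h2⟩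

/-- Theorem 5.2: for large `γ`, `u(·,γ)` has an `(n+1)`-th positive
critical point `s_{n+1}(γ)`, and `s_{n+1}(γ) → s_{n+1}*` as `γ → ∞`, hence
`λ_{n+1}(γ) = s_{n+1}(γ)² → λ_{n+1}* = (s_{n+1}*)²`. -/
theorem critical_points_converge (N : ℕ) (hN : 3 ≤ N) (p : ℝ) (hp : 1 < p)
    (hpS : pSob N < p)
    (ys ys' ys'' : ℝ → ℝ) (hys : IsEntireSingODE N p ys ys' ys'')
    (sstar : ℕ → ℝ) (hsm : StrictMono sstar) (hspos : ∀ k, 0 < sstar k)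
    (hschar : ∀ x : ℝ, 0 < x → (deriv (ustar N p ys) x = 0 ↔ ∃ k, sstar k = x))
    (U U' U'' : ℝ → ℝ → ℝ)
    (hU : ∀ γ > (1:ℝ), IsIVPSol N p γ (U γ) (U' γ) (U'' γ))
    (n : ℕ) :
    ∃ Γ > (1:ℝ), ∃ S : ℝ → ℝ,
      (∀ γ ≥ Γ, IsNthCritPt (U' γ) n (S γ)) ∧
      Tendsto S atTop (𝓝 (sstar n)) ∧
      Tendsto (fun γ => S γ ^ 2) atTop (𝓝 (sstar n ^ 2)) := by
  obtain ⟨δ₀, hδ₀, h⟩ :=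
    eventually_exists_isNthCritPt hN hp hpS hys hsm hspos hschar hU n
  classical
  set S : ℝ → ℝ := fun γ => if hS : ∃ s, IsNthCritPt (U' γ) n s then hS.choose else 0
  have hspec : ∀ γ s, IsNthCritPt (U' γ) n s → IsNthCritPt (U' γ) n (S γ) := by
    intro γ s hs
    have hS : ∃ s, IsNthCritPt (U' γ) n s := ⟨s, hs⟩
    simp only [S, dif_pos hS]
    exact hS.choose_spec
  have hlim : Tendsto S atTop (𝓝 (sstar n)) := by
    have hcont : Tendsto exp (𝓝 (Real.log (sstar n))) (𝓝 (sstar n)) := by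
      simpa only [Real.exp_log (hspos n)] using
        Real.continuous_exp.tendsto (Real.log (sstar n))
    rw [Metric.tendsto_nhds]
    intro ε hε
    obtain ⟨δ, hδ, hball⟩ := Metric.tendsto_nhds_nhds.1 hcont ε hε
    filter_upwards [h (min δ₀ (δ / 2)) (lt_min hδ₀ (half_pos hδ)) (min_le_left _ _)] with γ hγ
    obtain ⟨t, ht, hcrit⟩ := hγ
    rw [(hspec _ _ hcrit).unique hcrit]
    refine hball ?_
    rw [Real.dist_eq]
    exact (ht.trans (min_le_right _ _)).trans_lt (half_lt_self hδ)
  obtain ⟨Γ, hΓ⟩ := eventually_atTop.1 (h δ₀ hδ₀ le_rfl)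
  refine ⟨max Γ 2, lt_max_of_lt_right one_lt_two, S, fun γ hγ => ?_, hlim, hlim.pow 2⟩
  obtain ⟨t, -, hcrit⟩ := hΓ γ ((le_max_left _ _).trans hγ)
  exact hspec _ _ hcrit
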